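/- Let X be a Banach lattice with a directed bounded generating system Π such that σ(X) ∈ 𝔉_X^{⋆,μ} for every σ ∈ Π, for some μ ≥ 1. For each σ ∈ Π let (x_i^{(σ)}) be a basis for σ(X) satisfying (⋆) with constant μ in each summand, and let (e_n^{(σ)}) be the corresponding sequence of partial-sum (natural) projections. Let 𝒜 be a closed Riesz algebra ideal of ℒʳ(X) and let 𝔛 be a Banach lattice 𝒜-module. Assume, for each σ ∈ Π: (1) (x_i^{(σ)}) is shrinking; (2) {ab : a, b ∈ 𝒜_σ} = 𝒜_σ; (3) the linear maps E_σ, F_σ on 𝔛′ determined by E_σ x′ = sup_n e_n^{(σ)}·x′ and F_σ x′ = sup_n x′·e_n^{(σ)} for x′ ∈ 𝔛′₊ (module products in 𝔛_σ′) have weak*-closed ranges; and (4) sup_n e_n^{(σ)}·(a·x′) = a·x′ and sup_n (x′·a)·e_n^{(σ)} = x′·a for all a ∈ (𝒜_σ)₊ and x′ ∈ (𝔛_σ′)₊. Assume moreover that at least one of the following holds: (a) for each σ ∈ Π, with q_i^{(σ)} the rank-one basis projections of (x_i^{(σ)}), either no sequence (ξ_n) in 𝔛_σ′ with ξ_n ∈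 q_n^{(σ)}·𝔛_σ′·q_i^{(σ)} for all n (or ξ_n ∈ q_i^{(σ)}·𝔛_σ′·q_n^{(σ)} for all n) has a subsequence equivalent to the unit vector basis of c₀, or σ(X) is reflexive and dim(q_i^{(σ)}·𝔛_σ′·q_j^{(σ)}) < ∞ for all i, j; or (b) every bounded derivation from 𝒜ʳ(X) to 𝔛′ is inner. Then every bounded derivation D : 𝒜 → 𝔛′ such that D(a) = weak*-lim_σ D(σ∘a∘σ) for every a ∈ 𝒜 is regular. -/

import Mathlib

/- STATEMENT 8 (Theorem nonatomicmain): automatic regularity of bounded derivations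
   D from a closed Riesz algebra ideal of regular operators into a dual Banach lattice
   module, with D(a) = weak*-lim_sigma D(sigma a sigma), for X with a directed bounded
   generating system Pi whose ranges lie in F_X^{star,mu}. -/

open Filter Topology

section Prelude

variable {X 𝔛 : Type*} [NormedAddCommGroup X] [Lattice X] [HasSolidNorm X] [IsOrderedAddMonoid X] [NormedSpace ℝ X]
variable [NormedAddCommGroup 𝔛] [Lattice 𝔛] [HasSolidNorm 𝔛] [IsOrderedAddMonoid 𝔛] [NormedSpace ℝ 𝔛]

/-- A bounded operator is positive if it maps the positive cone into itself. -/
def IsPosOp (T : X →L[ℝ] X) : Prop := ∀ x : X, 0 ≤ x → 0 ≤ T x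

/-- The operator order on regular operators. -/
def opLe (S T : X →L[ℝ] X) : Prop := IsPosOp (T - S)

/-- ℒʳ(X): the regular operators, i.e. linear combinations of positive operators. -/
def LrSet (X : Type*) [NormedAddCommGroup X] [Lattice X] [HasSolidNorm X] [IsOrderedAddMonoid X] [NormedSpace ℝ X] :
    Set (X →L[ℝ] X) :=
  {T | ∃ (n : ℕ) (c : Fin n → ℝ) (S : Fin n → X →L[ℝ] X),
    (∀ i, IsPosOp (S i)) ∧ T = ∑ i, c i • S i}

/-- The regular norm ‖T‖ᵣ = inf{‖S‖ : |Tx| ≤ S|x| for all x}. -/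
noncomputable def rnorm (T : X →L[ℝ] X) : ℝ :=
  sInf {c : ℝ | ∃ S : X →L[ℝ] X, ‖S‖ = c ∧ ∀ x : X, |T x| ≤ S |x|}

/-- ℱ(X): continuous finite-rank operators. -/
def FinRankOp (T : X →L[ℝ] X) : Prop :=
  ∃ (n : ℕ) (f : Fin n → X →L[ℝ] ℝ) (v : Fin n → X), T = ∑ i, (f i).smulRight (v i)

/-- 𝒜ʳ(X): the ‖·‖ᵣ-closure of ℱ(X) in ℒʳ(X). -/
def ArSet (X : Type*) [NormedAddCommGroup X] [Lattice X] [HasSolidNorm X] [IsOrderedAddMonoid X] [NormedSpace ℝ X] :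
    Set (X →L[ℝ] X) :=
  {T | T ∈ LrSet X ∧ ∀ ε : ℝ, 0 < ε → ∃ F : X →L[ℝ] X, FinRankOp F ∧ rnorm (T - F) < ε}

/-- x is a normalized atom of the Banach lattice X. -/
def IsNormAtom (a : X) : Prop :=
  0 < a ∧ ‖a‖ = 1 ∧ ∀ y : X, 0 ≤ y → y ≤ a → ∃ c : ℝ, y = c • a

/-- The dual (pointwise-on-the-cone) order on 𝔛′ = 𝔛 →L[ℝ] ℝ. -/
def dualLe (f g : 𝔛 →L[ℝ] ℝ) : Prop := ∀ y : 𝔛, 0 ≤ y → f y ≤ g y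

/-- Least upper bound with respect to the dual order. -/
def dualIsLUB (S : Set (𝔛 →L[ℝ] ℝ)) (f : 𝔛 →L[ℝ] ℝ) : Prop :=
  (∀ g ∈ S, dualLe g f) ∧ ∀ h : 𝔛 →L[ℝ] ℝ, (∀ g ∈ S, dualLe g h) → dualLe f h

/-- A subset of the dual is weak*-closed. -/
def wstarClosed (S : Set (𝔛 →L[ℝ] ℝ)) : Prop :=
  IsClosed (StrongDual.toWeakDual '' S)

/-- (y i)_{i<n} and (z i)_{i<n} are L-equivalent. -/
def seqEquivUpTo (L : ℝ) (n : ℕ) (y z : ℕ → X) : Prop :=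
  ∀ α : ℕ → ℝ,
    ‖∑ i ∈ Finset.range n, α i • y i‖ ≤ L * ‖∑ i ∈ Finset.range n, α i • z i‖ ∧
    ‖∑ i ∈ Finset.range n, α i • z i‖ ≤ L * ‖∑ i ∈ Finset.range n, α i • y i‖

/-- The sequence (x i) satisfies the selection property (⋆) with constant μ. -/
def StarSeq (μ : ℝ) (x : ℕ → X) : Prop :=
  ∃ μs : ℕ → ℝ, (∀ n, 1 ≤ μs n ∧ μs n ≤ μ) ∧
    ∀ (n : ℕ) (l : ℕ → ℕ), 0 < n → (∀ i j, i < j → j < n → l i < l j) →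
      seqEquivUpTo (μs n) n x (fun i => x (l i)) →
      ∀ k : ℕ, ∃ m : ℕ, l (n - 1) + k ≤ m ∧
        seqEquivUpTo (μs (n + 1)) (n + 1) x (fun i => x (Function.update l n m i))

/-- (x i) is (an enumeration of the normalized atoms of X forming) a basis for
X = (⊕_n X_n)_𝐞 satisfying (⋆) with constant μ in each summand: there is a partition
of ℕ into slices (ψ n ·), n ∈ I, order preserving on each slice, such that on each
slice the (⋆)-property holds with constant μ, the slices are pairwise disjoint
sublattices, and the decomposition into slices is 1-unconditional. -/
def StarSummandBasis (μ : ℝ) (x : ℕ → X) : Prop :=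
  ∃ (I : Set ℕ) (ψ : ℕ → ℕ → ℕ),
    (∀ n ∈ I, StrictMono (ψ n)) ∧
    (∀ i : ℕ, ∃! p : ℕ × ℕ, p.1 ∈ I ∧ ψ p.1 p.2 = i) ∧
    (∀ n ∈ I, StarSeq μ (fun j => x (ψ n j))) ∧
    (∀ i, IsNormAtom (x i)) ∧
    (∀ a : X, IsNormAtom a → ∃ i, x i = a) ∧
    (∀ n ∈ I, ∀ m ∈ I, n ≠ m → ∀ j j' : ℕ, x (ψ n j) ⊓ x (ψ m j') = 0) ∧
    (∀ (s : Finset ℕ) (α ε : ℕ → ℝ),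
      (∀ n ∈ I, ∀ j j' : ℕ, ε (ψ n j) = ε (ψ n j')) → (∀ i, |ε i| ≤ 1) →
      ‖∑ i ∈ s, (ε i * α i) • x i‖ ≤ ‖∑ i ∈ s, α i • x i‖)

/-- A sequence in the dual is equivalent to the unit vector basis of c₀. -/
def EquivC0Basis (ξ : ℕ → (𝔛 →L[ℝ] ℝ)) : Prop :=
  ∃ L : ℝ, 0 < L ∧ ∀ (m : ℕ) (α : ℕ → ℝ),
    (∀ j < m, |α j| ≤ L * ‖∑ i ∈ Finset.range m, α i • ξ i‖) ∧
    (∀ B : ℝ, 0 ≤ B → (∀ i < m, |α i| ≤ B) →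
      ‖∑ i ∈ Finset.range m, α i • ξ i‖ ≤ L * B)

/-- A map D defined (at least) on A ⊆ ℒʳ(X), with values in 𝔛′, is regular if on A it
is a finite linear combination of positive linear maps. -/
def RegularDerivOn (A : Set (X →L[ℝ] X)) (D : (X →L[ℝ] X) → (𝔛 →L[ℝ] ℝ)) : Prop :=
  ∃ (n : ℕ) (c : Fin n → ℝ) (P : Fin n → (X →L[ℝ] X) → (𝔛 →L[ℝ] ℝ)),
    (∀ t, (∀ a ∈ A, ∀ b ∈ A, P t (a + b) = P t a + P t b) ∧
          (∀ (r : ℝ), ∀ a ∈ A, P t (r • a) = r • P t a) ∧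
          (∀ a ∈ A, IsPosOp a → dualLe 0 (P t a))) ∧
    ∀ a ∈ A, D a = ∑ t, c t • P t a

/-- 𝔛 contains a complemented subspace isomorphic to ℓ₁. -/
def HasComplementedL1 (𝔛 : Type*) [NormedAddCommGroup 𝔛] [Lattice 𝔛] [HasSolidNorm 𝔛] [IsOrderedAddMonoid 𝔛] [NormedSpace ℝ 𝔛] :
    Prop :=
  ∃ (P : 𝔛 →L[ℝ] 𝔛) (e : ℕ → 𝔛) (L : ℝ), 0 < L ∧ P ∘L P = P ∧
    (∀ y : 𝔛, P y ∈ closure (Submodule.span ℝ (Set.range e) : Set 𝔛)) ∧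
    (∀ i, P (e i) = e i) ∧
    (∀ (m : ℕ) (α : ℕ → ℝ),
      L⁻¹ * ∑ i ∈ Finset.range m, |α i| ≤ ‖∑ i ∈ Finset.range m, α i • e i‖ ∧
      ‖∑ i ∈ Finset.range m, α i • e i‖ ≤ L * ∑ i ∈ Finset.range m, |α i|)

end Prelude

section Prelude2

variable {X 𝔛 : Type*} [NormedAddCommGroup X] [Lattice X] [HasSolidNorm X] [IsOrderedAddMonoid X] [NormedSpace ℝ X]
variable [NormedAddCommGroup 𝔛] [Lattice 𝔛] [HasSolidNorm 𝔛] [IsOrderedAddMonoid 𝔛] [NormedSpace ℝ 𝔛]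

/-- a is a normalized atom of the sublattice V of X. -/
def IsNormAtomOn (V : Set X) (a : X) : Prop :=
  a ∈ V ∧ 0 < a ∧ ‖a‖ = 1 ∧ ∀ y ∈ V, 0 ≤ y → y ≤ a → ∃ c : ℝ, y = c • a

/-- (x i) is a basis of the sublattice V of X satisfying (⋆) with constant μ in each
summand of a 1-unconditional decomposition of V (this encodes V ∈ 𝔉_X^{⋆,μ} together
with the choice of such a basis). -/
def StarSummandBasisOn (V : Set X) (μ : ℝ) (x : ℕ → X) : Prop :=
  ∃ (I : Set ℕ) (ψ : ℕ → ℕ → ℕ),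
    (∀ n ∈ I, StrictMono (ψ n)) ∧
    (∀ i : ℕ, ∃! p : ℕ × ℕ, p.1 ∈ I ∧ ψ p.1 p.2 = i) ∧
    (∀ n ∈ I, StarSeq μ (fun j => x (ψ n j))) ∧
    (∀ i, IsNormAtomOn V (x i)) ∧
    (∀ a : X, IsNormAtomOn V a → ∃ i, x i = a) ∧
    (∀ n ∈ I, ∀ m ∈ I, n ≠ m → ∀ j j' : ℕ, x (ψ n j) ⊓ x (ψ m j') = 0) ∧
    (∀ (s : Finset ℕ) (α ε : ℕ → ℝ),
      (∀ n ∈ I, ∀ j j' : ℕ, ε (ψ n j) = ε (ψ n j')) → (∀ i, |ε i| ≤ 1) →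
      ‖∑ i ∈ s, (ε i * α i) • x i‖ ≤ ‖∑ i ∈ s, α i • x i‖)

/-- The partial-sum (natural) projections of a basis, as operators on X. -/
noncomputable def eproj (xb : ℕ → X) (xsb : ℕ → X →L[ℝ] ℝ) (n : ℕ) : X →L[ℝ] X :=
  ∑ i ∈ Finset.range n, (xsb i).smulRight (xb i)

/-- 𝒜_σ := {a ∈ ℒʳ(σ(X)) : ι_σ a p_σ ∈ 𝒜}, realised inside ℒʳ(X) as the set of
elements b of 𝒜 with σ ∘ b ∘ σ = b. -/
def ASigma (A : Set (X →L[ℝ] X)) (σ : X →L[ℝ] X) : Set (X →L[ℝ] X) :=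
  {b | b ∈ A ∧ σ ∘L (b ∘L σ) = b}

/-- The filter of "eventually for all σ large enough" along the directed set Π,
ordered by σ₁ ≼ σ₂ ⟺ σ₁(X) ⊆ σ₂(X). -/
def piFilter (Pi : Set (X →L[ℝ] X)) : Filter {σ : X →L[ℝ] X // σ ∈ Pi} :=
  ⨅ σ₀ : {σ : X →L[ℝ] X // σ ∈ Pi},
    Filter.principal {σ | Set.range ⇑(σ₀.val) ⊆ Set.range ⇑(σ.val)}

end Prelude2

section DualOrder

variable {E : Type*} [NormedAddCommGroup E] [Lattice E] [HasSolidNorm E] [IsOrderedAddMonoid E]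
  [NormedSpace ℝ E]

set_option linter.unusedSectionVars false

theorem smul_nonneg_of_hasSolidNorm {c : ℝ} (hc : 0 ≤ c) {x : E} (hx : 0 ≤ x) : 0 ≤ c • x := by
  have half : ∀ y : E, 0 ≤ y → 0 ≤ (2⁻¹ : ℝ) • y := fun y hy => by
    refine nsmul_two_semiclosed ?_
    rw [← Nat.cast_smul_eq_nsmul ℝ, smul_smul]
    simpa using hy
  have pow : ∀ k : ℕ, 0 ≤ ((2⁻¹ : ℝ) ^ k) • x := fun k => by
    induction k with
    | zero => simpa using hx
    | succ k ih => rw [pow_succ', mul_smul]; exact half _ ih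
  have dyadic : ∀ k : ℕ, 0 ≤ ((⌊c * 2 ^ k⌋₊ : ℝ) / 2 ^ k) • x := fun k => by
    rw [div_eq_mul_inv, ← inv_pow, mul_smul, Nat.cast_smul_eq_nsmul]
    exact nsmul_nonneg (pow k) _
  have lim : Tendsto (fun k : ℕ => ((⌊c * 2 ^ k⌋₊ : ℝ) / 2 ^ k)) atTop (𝓝 c) :=
    (tendsto_nat_floor_mul_div_atTop hc).comp (tendsto_pow_atTop_atTop_of_one_lt one_lt_two)
  exact ge_of_tendsto' (lim.smul_const x) dyadic

instance (priority := 100) HasSolidNorm.isOrderedModule : IsOrderedModule ℝ E :=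
  .of_smul_nonneg fun _ hc _ hx => smul_nonneg_of_hasSolidNorm hc hx

theorem dualLe.add {f g f' g' : E →L[ℝ] ℝ} (h₁ : dualLe f g) (h₂ : dualLe f' g') :
    dualLe (f + f') (g + g') :=
  fun y hy => add_le_add (h₁ y hy) (h₂ y hy)

theorem dualLe.sum {ι : Type*} {s : Finset ι} {f g : ι → E →L[ℝ] ℝ}
    (h : ∀ i ∈ s, dualLe (f i) (g i)) : dualLe (∑ i ∈ s, f i) (∑ i ∈ s, g i) := fun y hy => by
  simpa [sum_apply] using Finset.sum_le_sum fun i hi => h i hi y hy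

theorem dualLe.smul {f g : E →L[ℝ] ℝ} (h : dualLe f g) {c : ℝ} (hc : 0 ≤ c) :
    dualLe (c • f) (c • g) :=
  fun y hy => mul_le_mul_of_nonneg_left (h y hy) hc

theorem dualLe_zero_sub {f g : E →L[ℝ] ℝ} : dualLe 0 (g - f) ↔ dualLe f g :=
  forall₂_congr fun y _ => by simp

theorem abs_apply_le_of_dualLe {f : E →L[ℝ] ℝ} (hf : dualLe 0 f) (y : E) : |f y| ≤ f |y| := by
  have h₁ := hf (|y| - y) (sub_nonneg.2 (le_abs_self y))
  have h₂ := hf (|y| + y) (by simpa using add_le_add_left (neg_le_abs y) y)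
  simp only [map_sub, map_add, zero_apply] at h₁ h₂
  exact abs_le.2 ⟨by linarith, by linarith⟩

theorem norm_le_of_dualLe {f g : E →L[ℝ] ℝ} (hf : dualLe 0 f) (hfg : dualLe f g) : ‖f‖ ≤ ‖g‖ := by
  refine f.opNorm_le_bound (norm_nonneg _) fun y => ?_
  calc ‖f y‖ ≤ f |y| := abs_apply_le_of_dualLe hf y
    _ ≤ g |y| := hfg _ (abs_nonneg y)
    _ ≤ ‖g‖ * ‖|y|‖ := (le_abs_self _).trans (g.le_opNorm _)
    _ = ‖g‖ * ‖y‖ := by rw [norm_abs_eq_norm]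

theorem eq_of_forall_nonneg {f g : E →L[ℝ] ℝ} (h : ∀ y, 0 ≤ y → f y = g y) : f = g := by
  ext y
  rw [← posPart_sub_negPart y, map_sub, map_sub, h _ (posPart_nonneg y), h _ (negPart_nonneg y)]

/-- Every bounded functional on a normed lattice has a positive part, of no larger norm. -/
theorem exists_dual_posPart (f : E →L[ℝ] ℝ) :
    ∃ g : E →L[ℝ] ℝ, dualLe 0 g ∧ dualLe f g ∧ ‖g‖ ≤ ‖f‖ ∧
      ∀ h, dualLe 0 h → dualLe f h → dualLe g h := by
  have bound : ∀ y z : E, z ∈ Set.Icc 0 y → f z ≤ ‖f‖ * ‖y‖ := fun y z hz =>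
    (le_abs_self _).trans <| (f.le_opNorm z).trans <| mul_le_mul_of_nonneg_left
      (norm_le_norm_of_abs_le_abs (by
        rw [abs_of_nonneg hz.1, abs_of_nonneg (hz.1.trans hz.2)]; exact hz.2)) (norm_nonneg _)
  have bdd : ∀ y : E, BddAbove (f '' Set.Icc 0 y) := fun y =>
    ⟨‖f‖ * ‖y‖, by rintro _ ⟨z, hz, rfl⟩; exact bound y z hz⟩
  set p : E → ℝ := fun y => sSup (f '' Set.Icc 0 y) with hp
  have le_p : ∀ y z : E, 0 ≤ z → z ≤ y → f z ≤ p y := fun y z h₁ h₂ =>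
    le_csSup (bdd y) ⟨z, ⟨h₁, h₂⟩, rfl⟩
  have p_le : ∀ (y : E) (c : ℝ), 0 ≤ y → (∀ z, 0 ≤ z → z ≤ y → f z ≤ c) → p y ≤ c :=
    fun y c hy h => csSup_le ⟨_, 0, ⟨le_rfl, hy⟩, rfl⟩ (by
      rintro _ ⟨z, hz, rfl⟩; exact h z hz.1 hz.2)
  have p_nonneg : ∀ y : E, 0 ≤ y → 0 ≤ p y := fun y hy => by simpa using le_p y 0 le_rfl hy
  have p_add : ∀ a b : E, 0 ≤ a → 0 ≤ b → p (a + b) = p a + p b := by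
    intro a b ha hb
    apply le_antisymm
    · refine p_le _ _ (add_nonneg ha hb) fun z hz hzab => ?_
      have h₁ := le_p a (z ⊓ a) (le_inf hz ha) inf_le_right
      have h₂ := le_p b (z - z ⊓ a) (sub_nonneg.2 inf_le_left) (by
        rw [sub_le_iff_le_add, add_inf]
        exact le_inf (le_add_of_nonneg_left hb) (by rwa [add_comm]))
      rw [map_sub] at h₂
      linarith
    · have key : ∀ w, 0 ≤ w → w ≤ b → p a ≤ p (a + b) - f w := fun w hw hwb =>
        p_le _ _ ha fun z hz hza => by
          have := le_p (a + b) (z + w) (add_nonneg hz hw) (add_le_add hza hwb)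
          rw [map_add] at this
          linarith
      have := p_le b (p (a + b) - p a) hb fun w hw hwb => by linarith [key w hw hwb]
      linarith
  have p_bound : ∀ y, 0 ≤ y → p y ≤ ‖f‖ * ‖y‖ := fun y hy =>
    p_le _ _ hy fun z h₁ h₂ => bound y z ⟨h₁, h₂⟩
  have decomp : ∀ y a b : E, 0 ≤ a → 0 ≤ b → y = a - b → p y⁺ - p y⁻ = p a - p b := by
    intro y a b ha hb hy
    have h : y⁺ + b = a + y⁻ := by
      have := posPart_sub_negPart y
      rw [hy] at this ⊢
      rw [sub_eq_sub_iff_add_eq_add] at this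
      exact this
    have := congrArg p h
    rw [p_add _ _ (posPart_nonneg y) hb, p_add _ _ ha (negPart_nonneg y)] at this
    linarith
  let g₀ : E →+ ℝ := AddMonoidHom.mk' (fun y => p y⁺ - p y⁻) fun a b => by
    rw [decomp (a + b) (a⁺ + b⁺) (a⁻ + b⁻) (add_nonneg (posPart_nonneg a) (posPart_nonneg b))
      (add_nonneg (negPart_nonneg a) (negPart_nonneg b)), p_add _ _ (posPart_nonneg a)
      (posPart_nonneg b), p_add _ _ (negPart_nonneg a) (negPart_nonneg b)]
    · ring
    · conv_lhs => rw [← posPart_sub_negPart a, ← posPart_sub_negPart b]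
      abel
  have part_norm : ∀ y w : E, 0 ≤ w → w ≤ |y| → p w ≤ ‖f‖ * ‖y‖ := fun y w hw hwy =>
    (p_bound w hw).trans <| mul_le_mul_of_nonneg_left
      (norm_le_norm_of_abs_le_abs (by rwa [abs_of_nonneg hw])) (norm_nonneg _)
  have g₀_bound : ∀ y, ‖g₀ y‖ ≤ ‖f‖ * ‖y‖ := fun y => by
    have h₁ := part_norm y y⁺ (posPart_nonneg y) (sup_le (le_abs_self y) (abs_nonneg y))
    have h₂ := part_norm y y⁻ (negPart_nonneg y) (sup_le (neg_le_abs y) (abs_nonneg y))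
    have h₃ := p_nonneg _ (posPart_nonneg y)
    have h₄ := p_nonneg _ (negPart_nonneg y)
    exact abs_le.2 ⟨by change _ ≤ p y⁺ - p y⁻; linarith, by change p y⁺ - p y⁻ ≤ _; linarith⟩
  let g : E →L[ℝ] ℝ :=
    g₀.toRealLinearMap (AddMonoidHomClass.continuous_of_bound g₀ ‖f‖ g₀_bound)
  have g_pos : ∀ y, 0 ≤ y → g y = p y := fun y hy => by
    have p_zero : p 0 = 0 := by simpa using p_add 0 0 le_rfl le_rfl
    change p y⁺ - p y⁻ = p y
    rw [posPart_of_nonneg hy, negPart_of_nonneg hy, p_zero, sub_zero]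
  refine ⟨g, fun y hy => ?_, fun y hy => ?_, g.opNorm_le_bound (norm_nonneg _) g₀_bound,
    fun h h₀ hf y hy => ?_⟩
  · rw [g_pos y hy]; exact p_nonneg y hy
  · rw [g_pos y hy]; exact le_p y y hy le_rfl
  · rw [g_pos y hy]
    refine p_le _ _ hy fun z hz hzy => (hf z hz).trans ?_
    have := h₀ (y - z) (sub_nonneg.2 hzy)
    simp only [map_sub, zero_apply] at this
    linarith

/-- A chosen positive part of a bounded functional. -/
noncomputable def dualPos (f : E →L[ℝ] ℝ) : E →L[ℝ] ℝ := (exists_dual_posPart f).choose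

theorem dualPos_nonneg (f : E →L[ℝ] ℝ) : dualLe 0 (dualPos f) :=
  (exists_dual_posPart f).choose_spec.1

theorem le_dualPos (f : E →L[ℝ] ℝ) : dualLe f (dualPos f) :=
  (exists_dual_posPart f).choose_spec.2.1

theorem norm_dualPos_le (f : E →L[ℝ] ℝ) : ‖dualPos f‖ ≤ ‖f‖ :=
  (exists_dual_posPart f).choose_spec.2.2.1

theorem dualPos_le {f h : E →L[ℝ] ℝ} (h₀ : dualLe 0 h) (hf : dualLe f h) : dualLe (dualPos f) h :=
  (exists_dual_posPart f).choose_spec.2.2.2 h h₀ hf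

theorem exists_dual_sub (f : E →L[ℝ] ℝ) :
    ∃ g h : E →L[ℝ] ℝ, dualLe 0 g ∧ dualLe 0 h ∧ f = g - h :=
  ⟨dualPos f, dualPos f - f, dualPos_nonneg f, dualLe_zero_sub.2 (le_dualPos f), by simp⟩

/-- Bounded families of functionals have pointwise limits along ultrafilters. -/
theorem exists_ultrafilter_dual_limit {ι : Type*} (U : Ultrafilter ι) (f : ι → E →L[ℝ] ℝ) (C : ℝ)
    (hf : ∀ i, ‖f i‖ ≤ C) :
    ∃ g : E →L[ℝ] ℝ, ∀ y, Tendsto (fun i => f i y) U (𝓝 (g y)) := by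
  obtain ⟨g, -, hg⟩ := (WeakDual.isCompact_closedBall (𝕜 := ℝ) (E := E) 0 C).ultrafilter_le_nhds
    (U.map fun i => StrongDual.toWeakDual (f i)) (by
      refine le_principal_iff.2 (Ultrafilter.mem_map.2 (univ_mem' fun i => ?_))
      simpa using! hf i)
  refine ⟨WeakDual.toStrongDual g, fun y => ?_⟩
  exact ((WeakDual.eval_continuous y).tendsto g).comp hg

/-- The supremum of an increasing sequence of functionals is its pointwise limit. -/
theorem tendsto_of_dualIsLUB {u : ℕ → E →L[ℝ] ℝ} {f : E →L[ℝ] ℝ}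
    (hu : ∀ n m, n ≤ m → dualLe (u n) (u m)) (h0 : ∀ n, dualLe 0 (u n))
    (hf : dualIsLUB (Set.range u) f) (y : E) :
    Tendsto (fun n => u n y) atTop (𝓝 (f y)) := by
  have le_f : ∀ n, dualLe (u n) f := fun n => hf.1 _ ⟨n, rfl⟩
  obtain ⟨g, hg⟩ := exists_ultrafilter_dual_limit (hyperfilter ℕ) u ‖f‖
    fun n => norm_le_of_dualLe (h0 n) (le_f n)
  have conv : ∀ y, 0 ≤ y → Tendsto (fun n => u n y) atTop (𝓝 (g y)) := fun y hy => by
    have h := tendsto_atTop_ciSup (f := fun n => u n y) (fun n m hnm => hu n m hnm y hy)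
      ⟨f y, by rintro _ ⟨n, rfl⟩; exact le_f n y hy⟩
    rwa [tendsto_nhds_unique (hg y) (h.mono_left Nat.hyperfilter_le_atTop)]
  have hgf : g = f := eq_of_forall_nonneg fun y hy => le_antisymm
    (le_of_tendsto' (conv y hy) fun n => le_f n y hy)
    (hf.2 g (by
      rintro _ ⟨n, rfl⟩ y hy
      exact ge_of_tendsto (conv y hy) (eventually_atTop.2 ⟨n, fun m hm => hu n m hm y hy⟩)) y hy)
  rw [← hgf, ← posPart_sub_negPart y]
  simp only [map_sub]
  exact (conv _ (posPart_nonneg y)).sub (conv _ (negPart_nonneg y))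

end DualOrder

section PositiveOperators

variable {X : Type*} [NormedAddCommGroup X] [Lattice X] [HasSolidNorm X] [IsOrderedAddMonoid X]
  [NormedSpace ℝ X]

set_option linter.unusedSectionVars false

theorem IsPosOp.mem_LrSet {T : X →L[ℝ] X} (hT : IsPosOp T) : T ∈ LrSet X :=
  ⟨1, fun _ => 1, fun _ => T, fun _ => hT, by simp⟩

theorem IsPosOp.comp {S T : X →L[ℝ] X} (hS : IsPosOp S) (hT : IsPosOp T) : IsPosOp (S ∘L T) :=
  fun x hx => hS _ (hT x hx)

theorem IsPosOp.sum {ι : Type*} {s : Finset ι} {T : ι → X →L[ℝ] X} (hT : ∀ i ∈ s, IsPosOp (T i)) :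
    IsPosOp (∑ i ∈ s, T i) := fun x hx => by
  rw [sum_apply]
  exact Finset.sum_nonneg fun i hi => hT i hi x hx

theorem IsPosOp.mono {T : X →L[ℝ] X} (hT : IsPosOp T) {x y : X} (h : x ≤ y) : T x ≤ T y := by
  have := hT (y - x) (sub_nonneg.2 h)
  rwa [map_sub, sub_nonneg] at this

theorem IsPosOp.abs_apply_le {T : X →L[ℝ] X} (hT : IsPosOp T) (x : X) : |T x| ≤ T |x| := by
  refine abs_le'.2 ⟨hT.mono (le_abs_self x), ?_⟩
  rw [← map_neg]
  exact hT.mono (neg_le_abs x)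

theorem rnorm_nonneg (T : X →L[ℝ] X) : 0 ≤ rnorm T :=
  Real.sInf_nonneg (by rintro _ ⟨S, rfl, -⟩; exact norm_nonneg S)

theorem rnorm_le {T S : X →L[ℝ] X} (h : ∀ x, |T x| ≤ S |x|) : rnorm T ≤ ‖S‖ :=
  csInf_le ⟨0, by rintro _ ⟨S, rfl, -⟩; exact norm_nonneg S⟩ ⟨S, rfl, h⟩

theorem IsPosOp.rnorm_le {T : X →L[ℝ] X} (hT : IsPosOp T) : rnorm T ≤ ‖T‖ :=
  _root_.rnorm_le hT.abs_apply_le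

theorem abs_smul_le_of_nonneg {c d : ℝ} (h : |c| ≤ d) {x : X} (hx : 0 ≤ x) : |c • x| ≤ d • x := by
  refine abs_le'.2 ⟨smul_le_smul_of_nonneg_right ((le_abs_self c).trans h) hx, ?_⟩
  rw [← neg_smul]
  exact smul_le_smul_of_nonneg_right ((neg_le_abs c).trans h) hx

theorem abs_finset_sum_le {ι : Type*} (s : Finset ι) (f : ι → X) :
    |∑ i ∈ s, f i| ≤ ∑ i ∈ s, |f i| :=
  Finset.le_sum_of_subadditive (fun x : X => |x|) abs_zero.le abs_add_le s f

/-- A functional on a normed lattice is dominated by a positive one. -/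
theorem exists_dominating_functional (f : X →L[ℝ] ℝ) :
    ∃ g : X →L[ℝ] ℝ, (∀ x, |f x| ≤ g |x|) ∧ ‖g‖ ≤ 2 * ‖f‖ := by
  refine ⟨dualPos f + dualPos (-f), fun x => ?_, ?_⟩
  · have key : ∀ y, 0 ≤ y → |f y| ≤ (dualPos f + dualPos (-f)) y := fun y hy => by
      have h₁ := le_dualPos f y hy
      have h₂ := le_dualPos (-f) y hy
      have h₃ := dualPos_nonneg f y hy
      have h₄ := dualPos_nonneg (-f) y hy
      simp only [zero_apply, neg_apply] at h₂ h₃ h₄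
      exact abs_le'.2 ⟨by simp only [add_apply]; linarith, by simp only [add_apply]; linarith⟩
    calc |f x| = |f x⁺ - f x⁻| := by rw [← map_sub, posPart_sub_negPart]
      _ ≤ |f x⁺| + |f x⁻| := abs_sub _ _
      _ ≤ _ := add_le_add (key _ (posPart_nonneg x)) (key _ (negPart_nonneg x))
      _ = _ := by rw [← map_add, posPart_add_negPart]
  · refine (norm_add_le _ _).trans ?_
    have h₁ := norm_dualPos_le f
    have h₂ := norm_dualPos_le (-f)
    rw [norm_neg] at h₂
    linarith

theorem exists_dominating_smulRight (f : X →L[ℝ] ℝ) (z : X) :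
    ∃ S : X →L[ℝ] X, (∀ x, |f.smulRight z x| ≤ S |x|) ∧ ‖S‖ ≤ 2 * ‖f‖ * ‖z‖ := by
  obtain ⟨g, hg, hgn⟩ := exists_dominating_functional f
  refine ⟨g.smulRight |z|, fun x => ?_, ?_⟩
  · simp only [ContinuousLinearMap.smulRight_apply]
    have h : ∀ c d : ℝ, |c| ≤ d → c • z ≤ d • |z| := fun c d hcd => by
      calc c • z = c • z⁺ - c • z⁻ := by rw [← smul_sub, posPart_sub_negPart]
        _ ≤ d • z⁺ + d • z⁻ := by
          rw [sub_eq_add_neg, ← neg_smul]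
          exact add_le_add
            (smul_le_smul_of_nonneg_right ((le_abs_self c).trans hcd) (posPart_nonneg z))
            (smul_le_smul_of_nonneg_right ((neg_le_abs c).trans hcd) (negPart_nonneg z))
        _ = d • |z| := by rw [← smul_add, posPart_add_negPart]
    refine abs_le'.2 ⟨h _ _ (hg x), ?_⟩
    rw [← neg_smul]
    exact h _ _ (by rw [abs_neg]; exact hg x)
  · rw [ContinuousLinearMap.norm_smulRight_apply, norm_abs_eq_norm]
    exact mul_le_mul_of_nonneg_right hgn (norm_nonneg z)

theorem rnorm_sum_smulRight_le {ι : Type*} (s : Finset ι) (f : ι → X →L[ℝ] ℝ) (z : ι → X) :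
    rnorm (∑ i ∈ s, (f i).smulRight (z i)) ≤ ∑ i ∈ s, 2 * ‖f i‖ * ‖z i‖ := by
  choose S hS hSn using fun i => exists_dominating_smulRight (f i) (z i)
  refine (rnorm_le (S := ∑ i ∈ s, S i) fun x => ?_).trans
    ((norm_sum_le _ _).trans (Finset.sum_le_sum fun i _ => hSn i))
  rw [sum_apply, sum_apply]
  exact (abs_finset_sum_le s _).trans (Finset.sum_le_sum fun i _ => hS i x)

/-- A shrinking basis of positive vectors, with positive coefficient functionals, for the range
of a positive projection. -/
structure IsPositiveBasis (σ : X →L[ℝ] X) (x : ℕ → X) (s : ℕ → X →L[ℝ] ℝ) : Prop where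
  proj_pos : IsPosOp σ
  vec_nonneg : ∀ i, 0 ≤ x i
  coeff_nonneg : ∀ i, dualLe 0 (s i)
  coeff_comp : ∀ i, (s i).comp σ = s i
  proj_vec : ∀ i, σ (x i) = x i
  biorth : ∀ i j, s i (x j) = if i = j then (1 : ℝ) else 0
  tendsto_eproj : ∀ y, Tendsto (fun n => eproj x s n (σ y)) atTop (𝓝 (σ y))
  shrinking : ∀ l : X →L[ℝ] ℝ,
    Tendsto (fun n => ‖(l - l.comp (eproj x s n)).comp σ‖) atTop (𝓝 0)

namespace IsPositiveBasis

variable {σ : X →L[ℝ] X} {x : ℕ → X} {s : ℕ → X →L[ℝ] ℝ}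

theorem eproj_apply (x : ℕ → X) (s : ℕ → X →L[ℝ] ℝ) (n : ℕ) (y : X) :
    eproj x s n y = ∑ i ∈ Finset.range n, s i y • x i := by
  simp [eproj, sum_apply]

theorem smulRight_pos (h : IsPositiveBasis σ x s) (i j : ℕ) : IsPosOp ((s j).smulRight (x i)) :=
  fun y hy => smul_nonneg (h.coeff_nonneg j y hy) (h.vec_nonneg i)

theorem eproj_pos (h : IsPositiveBasis σ x s) (n : ℕ) : IsPosOp (eproj x s n) :=
  IsPosOp.sum fun i _ => h.smulRight_pos i i

theorem eproj_sub_pos (h : IsPositiveBasis σ x s) {n m : ℕ} (hnm : n ≤ m) :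
    IsPosOp (eproj x s m - eproj x s n) := fun y hy => by
  rw [sub_apply, sub_nonneg, eproj_apply, eproj_apply]
  exact Finset.sum_le_sum_of_subset_of_nonneg (Finset.range_mono hnm)
    fun i _ _ => h.smulRight_pos i i y hy

theorem eproj_proj (h : IsPositiveBasis σ x s) (n : ℕ) : eproj x s n ∘L σ = eproj x s n := by
  ext y
  simp only [ContinuousLinearMap.comp_apply, eproj_apply]
  refine Finset.sum_congr rfl fun i _ => ?_
  rw [← ContinuousLinearMap.comp_apply, h.coeff_comp]

theorem proj_eproj (h : IsPositiveBasis σ x s) (n : ℕ) : σ ∘L eproj x s n = eproj x s n := by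
  ext y
  simp [eproj_apply, h.proj_vec]

theorem eproj_le (h : IsPositiveBasis σ x s) (n : ℕ) {y : X} (hy : 0 ≤ y) :
    eproj x s n y ≤ σ y := by
  refine ge_of_tendsto (h.tendsto_eproj y) (eventually_atTop.2 ⟨n, fun m hm => ?_⟩)
  have := h.eproj_sub_pos hm y hy
  rw [sub_apply, sub_nonneg] at this
  rwa [← ContinuousLinearMap.comp_apply, h.eproj_proj]

theorem rnorm_signed_le (h : IsPositiveBasis σ x s) (n : ℕ) (ε : ℕ → ℝ) (hε : ∀ i, |ε i| ≤ 1) :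
    rnorm (∑ i ∈ Finset.range n, ε i • (s i).smulRight (x i)) ≤ ‖σ‖ := by
  refine rnorm_le fun y => ?_
  refine le_trans ?_ (h.eproj_le n (abs_nonneg y))
  rw [sum_apply, eproj_apply]
  refine (abs_finset_sum_le _ _).trans (Finset.sum_le_sum fun i _ => ?_)
  rw [smul_apply, ContinuousLinearMap.smulRight_apply, smul_smul]
  refine abs_smul_le_of_nonneg ?_ (h.vec_nonneg i)
  rw [abs_mul]
  exact (mul_le_of_le_one_left (abs_nonneg _) (hε i)).trans
    (abs_apply_le_of_dualLe (h.coeff_nonneg i) y)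

theorem norm_le_of_abs_le {T S : X →L[ℝ] X} (hTS : ∀ x, |T x| ≤ S |x|) : ‖T‖ ≤ ‖S‖ :=
  T.opNorm_le_bound (norm_nonneg _) fun x => by
    calc ‖T x‖ ≤ ‖S |x|‖ := norm_le_norm_of_abs_le_abs ((hTS x).trans (le_abs_self _))
      _ ≤ ‖S‖ * ‖|x|‖ := S.le_opNorm _
      _ = ‖S‖ * ‖x‖ := by rw [norm_abs_eq_norm]

theorem norm_eproj_le (h : IsPositiveBasis σ x s) (n : ℕ) : ‖eproj x s n‖ ≤ ‖σ‖ :=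
  norm_le_of_abs_le fun y =>
    ((h.eproj_pos n).abs_apply_le y).trans (h.eproj_le n (abs_nonneg y))

theorem rnorm_eproj_le (h : IsPositiveBasis σ x s) (n : ℕ) : rnorm (eproj x s n) ≤ ‖σ‖ :=
  (h.eproj_pos n).rnorm_le.trans (h.norm_eproj_le n)

theorem eproj_comp_smulRight (c : X →L[ℝ] X) (k : ℕ) :
    c ∘L eproj x s k = ∑ i ∈ Finset.range k, (s i).smulRight (c (x i)) := by
  ext y
  simp [eproj_apply, sum_apply]

theorem eproj_comp_eq (b : X →L[ℝ] X) (n : ℕ) :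
    eproj x s n ∘L b = ∑ i ∈ Finset.range n, ((s i).comp b).smulRight (x i) := by
  ext y
  simp [eproj_apply, sum_apply]

theorem tendsto_rnorm_left (h : IsPositiveBasis σ x s) {c : X →L[ℝ] X} (hc : σ ∘L (c ∘L σ) = c)
    (k : ℕ) :
    Tendsto (fun n => rnorm (c ∘L eproj x s k - eproj x s n ∘L (c ∘L eproj x s k)))
      atTop (𝓝 0) := by
  have eq : ∀ n, c ∘L eproj x s k - eproj x s n ∘L (c ∘L eproj x s k) =
      ∑ i ∈ Finset.range k, (s i).smulRight (c (x i) - eproj x s n (c (x i))) := fun n => by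
    rw [← ContinuousLinearMap.comp_assoc, eproj_comp_smulRight, eproj_comp_smulRight,
      ← Finset.sum_sub_distrib]
    refine Finset.sum_congr rfl fun i _ => ?_
    ext y
    simp [smul_sub]
  have lim : Tendsto (fun n => ∑ i ∈ Finset.range k,
      2 * ‖s i‖ * ‖c (x i) - eproj x s n (c (x i))‖) atTop (𝓝 0) := by
    rw [show 𝓝 (0 : ℝ) = 𝓝 (∑ _i ∈ Finset.range k, (0 : ℝ)) by rw [Finset.sum_const_zero]]
    refine tendsto_finsetSum _ fun i _ => ?_
    have h₁ := h.tendsto_eproj (c (σ (x i)))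
    have h₂ : σ (c (σ (x i))) = c (x i) := congrArg (fun T : X →L[ℝ] X => T (x i)) hc
    rw [h₂] at h₁
    simpa using ((tendsto_const_nhds (x := c (x i))).sub h₁).norm.const_mul (2 * ‖s i‖)
  refine squeeze_zero (fun n => rnorm_nonneg _) (fun n => ?_) lim
  rw [eq]
  exact rnorm_sum_smulRight_le _ _ _

theorem tendsto_rnorm_right (h : IsPositiveBasis σ x s) {b : X →L[ℝ] X} (hb : b ∘L σ = b)
    (n : ℕ) :
    Tendsto (fun m => rnorm (eproj x s n ∘L b - eproj x s n ∘L (b ∘L eproj x s m)))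
      atTop (𝓝 0) := by
  have eq : ∀ m, eproj x s n ∘L b - eproj x s n ∘L (b ∘L eproj x s m) =
      ∑ i ∈ Finset.range n, (((s i).comp b - ((s i).comp b).comp (eproj x s m)).comp σ).smulRight
        (x i) := fun m => by
    rw [eproj_comp_eq, eproj_comp_eq, ← Finset.sum_sub_distrib]
    refine Finset.sum_congr rfl fun i _ => ?_
    ext y
    have h₁ : b (σ y) = b y := congrArg (fun T : X →L[ℝ] X => T y) hb
    have h₂ : eproj x s m (σ y) = eproj x s m y :=
      congrArg (fun T : X →L[ℝ] X => T y) (h.eproj_proj m)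
    simp [sub_smul, h₁, h₂]
  have lim : Tendsto (fun m => ∑ i ∈ Finset.range n,
      2 * ‖((s i).comp b - ((s i).comp b).comp (eproj x s m)).comp σ‖ * ‖x i‖)
      atTop (𝓝 0) := by
    rw [show 𝓝 (0 : ℝ) = 𝓝 (∑ _i ∈ Finset.range n, (0 : ℝ)) by rw [Finset.sum_const_zero]]
    refine tendsto_finsetSum _ fun i _ => ?_
    simpa using ((h.shrinking ((s i).comp b)).const_mul 2).mul_const ‖x i‖
  refine squeeze_zero (fun m => rnorm_nonneg _) (fun m => ?_) lim
  rw [eq]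
  exact rnorm_sum_smulRight_le _ _ _

end IsPositiveBasis

theorem add_inf_eq_zero {a b c : X} (hb : 0 ≤ b) (ha : 0 ≤ a) (hc : 0 ≤ c) (hac : a ⊓ c = 0)
    (hbc : b ⊓ c = 0) : (a + b) ⊓ c = 0 := by
  refine le_antisymm ?_ (le_inf (add_nonneg ha hb) hc)
  rw [← hbc]
  refine le_inf ?_ inf_le_right
  rw [← sub_nonpos, ← hac]
  exact le_inf (sub_le_iff_le_add.2 inf_le_left) ((sub_le_self _ hb).trans inf_le_right)

theorem sum_inf_eq_zero {ι : Type*} (s : Finset ι) (f : ι → X) {c : X} (hc : 0 ≤ c)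
    (hf : ∀ i ∈ s, 0 ≤ f i) (h : ∀ i ∈ s, f i ⊓ c = 0) : (∑ i ∈ s, f i) ⊓ c = 0 := by
  classical
  induction s using Finset.induction_on with
  | empty => simpa using hc
  | insert i s hi ih =>
    rw [Finset.sum_insert hi]
    simp only [Finset.mem_insert, forall_eq_or_imp] at hf h
    exact add_inf_eq_zero (Finset.sum_nonneg hf.2) hf.1 hc h.1 (ih hf.2 h.2)

theorem abs_sum_smul_of_disjoint (x : ℕ → X) (hx : ∀ i, 0 ≤ x i)
    (hd : ∀ i j, i ≠ j → ∀ a b : ℝ, 0 ≤ a → 0 ≤ b → (a • x i) ⊓ (b • x j) = 0)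
    (s : Finset ℕ) (α : ℕ → ℝ) :
    |∑ i ∈ s, α i • x i| = ∑ i ∈ s, |α i| • x i := by
  have hdis : (∑ i ∈ s, (α i)⁺ • x i) ⊓ (∑ i ∈ s, (α i)⁻ • x i) = 0 := by
    have pos : ∀ i ∈ s, 0 ≤ (α i)⁺ • x i := fun i _ => smul_nonneg (posPart_nonneg _) (hx i)
    have neg : ∀ i ∈ s, 0 ≤ (α i)⁻ • x i := fun i _ => smul_nonneg (negPart_nonneg _) (hx i)
    refine sum_inf_eq_zero s _ (Finset.sum_nonneg neg) pos fun i hi => ?_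
    rw [inf_comm]
    refine sum_inf_eq_zero s _ (pos i hi) neg fun j _ => ?_
    by_cases hij : j = i
    · subst hij
      rcases le_total 0 (α j) with h | h
      · rw [negPart_of_nonneg h, zero_smul]; exact inf_eq_left.2 (pos j hi)
      · rw [posPart_of_nonpos h, zero_smul]; exact inf_eq_right.2 (neg j hi)
    · exact hd j i hij _ _ (negPart_nonneg _) (posPart_nonneg _)
  have h₁ : ∑ i ∈ s, α i • x i = ∑ i ∈ s, (α i)⁺ • x i - ∑ i ∈ s, (α i)⁻ • x i := by
    rw [← Finset.sum_sub_distrib]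
    exact Finset.sum_congr rfl fun i _ => by rw [← sub_smul, posPart_sub_negPart]
  have h₂ : ∑ i ∈ s, |α i| • x i = ∑ i ∈ s, (α i)⁺ • x i + ∑ i ∈ s, (α i)⁻ • x i := by
    rw [← Finset.sum_add_distrib]
    exact Finset.sum_congr rfl fun i _ => by rw [← add_smul, posPart_add_negPart]
  rw [h₁, h₂, abs_sub_comm, ← sup_sub_inf_eq_abs_sub, hdis, sub_zero, ← inf_add_sup, hdis,
    zero_add]

theorem isPositiveBasis_of_atoms {σ : X →L[ℝ] X} {x : ℕ → X} {s : ℕ → X →L[ℝ] ℝ}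
    (hpos : IsPosOp σ) (hproj : σ ∘L σ = σ)
    (hriesz : ∀ y ∈ Set.range ⇑σ, ∀ z ∈ Set.range ⇑σ, y ⊔ z ∈ Set.range ⇑σ)
    (hatom : ∀ i, IsNormAtomOn (Set.range ⇑σ) (x i))
    (hcomp : ∀ i, (s i).comp σ = s i)
    (hbi : ∀ i j, s i (x j) = if i = j then (1 : ℝ) else 0)
    (hbasis : ∀ y ∈ Set.range ⇑σ, Tendsto (fun n => eproj x s n y) atTop (𝓝 y))
    (hshrink : ∀ l : X →L[ℝ] ℝ,
      Tendsto (fun n => sSup {r : ℝ | ∃ y ∈ Set.range ⇑σ, ‖y‖ ≤ 1 ∧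
        r = |l y - l (eproj x s n y)|}) atTop (𝓝 0)) :
    IsPositiveBasis σ x s := by
  have fixed : ∀ y ∈ Set.range ⇑σ, σ y = y := by
    rintro _ ⟨y, rfl⟩
    exact congrArg (fun T : X →L[ℝ] X => T y) hproj
  have smul_mem : ∀ (c : ℝ), ∀ y ∈ Set.range ⇑σ, c • y ∈ Set.range ⇑σ := by
    rintro c _ ⟨y, rfl⟩
    exact ⟨c • y, map_smul σ c y⟩
  have inf_mem : ∀ y ∈ Set.range ⇑σ, ∀ z ∈ Set.range ⇑σ, y ⊓ z ∈ Set.range ⇑σ := by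
    intro y hy z hz
    refine ⟨y + z - y ⊔ z, ?_⟩
    rw [map_sub, map_add, fixed y hy, fixed z hz, fixed _ (hriesz y hy z hz), ← inf_add_sup y z,
      add_sub_cancel_right]
  have hx : ∀ i, 0 ≤ x i := fun i => (hatom i).2.1.le
  have below : ∀ i (a : ℝ) (z : X), 0 ≤ a → z ∈ Set.range ⇑σ → 0 ≤ z → z ≤ a • x i →
      ∃ c : ℝ, z = c • x i := by
    intro i a z ha hz hz0 hza
    rcases ha.eq_or_lt with rfl | ha'
    · exact ⟨0, by rw [zero_smul] at hza ⊢; exact le_antisymm hza hz0⟩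
    · obtain ⟨c, hc⟩ := (hatom i).2.2.2 (a⁻¹ • z) (smul_mem _ z hz)
        (smul_nonneg (inv_nonneg.2 ha) hz0) ((inv_smul_le_iff_of_pos ha').2 hza)
      exact ⟨a * c, by rw [mul_smul, ← hc, smul_inv_smul₀ ha'.ne']⟩
  have disj : ∀ i j, i ≠ j → ∀ a b : ℝ, 0 ≤ a → 0 ≤ b → (a • x i) ⊓ (b • x j) = 0 := by
    intro i j hij a b ha hb
    have hmem := inf_mem _ (smul_mem a _ (hatom i).1) _ (smul_mem b _ (hatom j).1)
    have h0 : 0 ≤ (a • x i) ⊓ (b • x j) := le_inf (smul_nonneg ha (hx i)) (smul_nonneg hb (hx j))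
    obtain ⟨c, hc⟩ := below i a _ ha hmem h0 inf_le_left
    obtain ⟨d, hd⟩ := below j b _ hb hmem h0 inf_le_right
    have := congrArg (s i) (hc.symm.trans hd)
    simp only [map_smul, hbi, if_neg hij, smul_eq_mul, mul_one, mul_zero, if_true] at this
    rw [hc, this, zero_smul]
  have coeff : ∀ j, ∀ y ∈ Set.range ⇑σ, 0 ≤ y → 0 ≤ s j y := by
    intro j y hy hy0
    have h₁ : Tendsto (fun n => s j |eproj x s n y|) atTop (𝓝 (s j y)) := by
      have habs := ((continuous_id.sup continuous_neg).tendsto y).comp (hbasis y hy)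
      have := ((s j).continuous.tendsto _).comp habs
      simpa only [id, Function.comp_def, abs_of_nonneg hy0] using
        (show Tendsto (fun n => s j |eproj x s n y|) atTop (𝓝 (s j |y|)) from this)
    refine ge_of_tendsto h₁ (eventually_atTop.2 ⟨j + 1, fun n hn => ?_⟩)
    rw [IsPositiveBasis.eproj_apply, abs_sum_smul_of_disjoint x hx disj, map_sum]
    refine Finset.sum_nonneg fun i _ => ?_
    rw [map_smul, hbi, smul_eq_mul]
    positivity
  refine ⟨hpos, hx, fun i y hy => ?_, hcomp, fun i => fixed _ (hatom i).1, hbi,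
    fun y => hbasis _ ⟨y, rfl⟩, fun l => ?_⟩
  · rw [← hcomp i]
    exact coeff i _ ⟨y, rfl⟩ (hpos y hy)
  · have lim := (hshrink l).mul_const ‖σ‖
    rw [zero_mul] at lim
    refine squeeze_zero (fun n => norm_nonneg _) (fun n => ?_) lim
    set R := {r : ℝ | ∃ y ∈ Set.range ⇑σ, ‖y‖ ≤ 1 ∧ r = |l y - l (eproj x s n y)|} with hR
    have bdd : BddAbove R := by
      refine ⟨‖l - l.comp (eproj x s n)‖, ?_⟩
      rintro _ ⟨y, -, hy1, rfl⟩
      exact ((l - l.comp (eproj x s n)).le_opNorm y).trans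
        (mul_le_of_le_one_right (norm_nonneg _) hy1)
    have sup_nonneg : 0 ≤ sSup R := Real.sSup_nonneg (by rintro _ ⟨y, -, -, rfl⟩; positivity)
    refine ContinuousLinearMap.opNorm_le_bound _ (by positivity) fun y => ?_
    have main : ‖(l - l.comp (eproj x s n)) (σ y)‖ ≤ sSup R * ‖σ y‖ := by
      rcases eq_or_ne (σ y) 0 with h0 | h0
      · simp [h0]
      · have hn : 0 < ‖σ y‖ := norm_pos_iff.2 h0
        have := le_csSup bdd (a := ‖σ y‖⁻¹ * ‖(l - l.comp (eproj x s n)) (σ y)‖)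
          ⟨‖σ y‖⁻¹ • σ y, smul_mem _ _ ⟨y, rfl⟩, by
            rw [norm_smul, norm_inv, norm_norm, inv_mul_cancel₀ hn.ne'], by
            simp only [map_smul, smul_eq_mul, ← mul_sub, abs_mul, abs_inv, abs_norm]
            rfl⟩
        rwa [inv_mul_le_iff₀ hn, mul_comm] at this
    rw [mul_assoc]
    exact main.trans (mul_le_mul_of_nonneg_left (σ.le_opNorm y) sup_nonneg)

end PositiveOperators

section DerivationDomination

variable {X 𝔛 : Type*} [NormedAddCommGroup X] [Lattice X] [HasSolidNorm X] [IsOrderedAddMonoid X]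
  [NormedSpace ℝ X]
variable [NormedAddCommGroup 𝔛] [Lattice 𝔛] [HasSolidNorm 𝔛] [IsOrderedAddMonoid 𝔛]
  [NormedSpace ℝ 𝔛]

set_option linter.unusedSectionVars false

/-- Averaging over signs: a bound for a bilinear map on the diagonal, at all signed sums of a
sequence, passes to the sum of its diagonal values along the sequence. -/
theorem norm_add_sum_diagonal_le {V W : Type*} [AddCommGroup V] [Module ℝ V]
    [NormedAddCommGroup W] [NormedSpace ℝ W] (B : V →ₗ[ℝ] V →ₗ[ℝ] W) (q : ℕ → V) (C : ℝ) (n : ℕ)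
    (z : W)
    (h : ∀ ε : ℕ → ℝ, (∀ i, |ε i| ≤ 1) →
      ‖z + B (∑ i ∈ Finset.range n, ε i • q i) (∑ i ∈ Finset.range n, ε i • q i)‖ ≤ C) :
    ‖z + ∑ i ∈ Finset.range n, B (q i) (q i)‖ ≤ C := by
  induction n generalizing z with
  | zero => simpa using h (fun _ => 0) (by simp)
  | succ n ih =>
    rw [Finset.sum_range_succ, add_comm _ (B (q n) (q n)), ← add_assoc]
    refine ih _ fun ε hε => ?_
    set S := ∑ i ∈ Finset.range n, ε i • q i with hS
    have signed : ∀ c : ℝ, |c| ≤ 1 → ‖z + B (S + c • q n) (S + c • q n)‖ ≤ C := fun c hc => by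
      have := h (Function.update ε n c) fun i => by
        by_cases hi : i = n
        · subst hi; simpa using hc
        · simpa [hi] using hε i
      rw [Finset.sum_range_succ, Function.update_self] at this
      rwa [Finset.sum_congr rfl fun i hi => by
        rw [Function.update_of_ne (Finset.mem_range.1 hi).ne]] at this
    have avg : z + B (q n) (q n) + B S S = (2⁻¹ : ℝ) • (z + B (S + (1 : ℝ) • q n) (S + (1 : ℝ) • q n))
        + (2⁻¹ : ℝ) • (z + B (S + (-1 : ℝ) • q n) (S + (-1 : ℝ) • q n)) := by
      simp only [map_add, map_smul, LinearMap.add_apply, LinearMap.smul_apply]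
      module
    rw [avg]
    refine (norm_add_le _ _).trans ?_
    rw [norm_smul, norm_smul]
    have h₁ := signed 1 (by simp)
    have h₂ := signed (-1) (by simp)
    rw [Real.norm_of_nonneg (by norm_num : (0 : ℝ) ≤ 2⁻¹)]
    linarith

/-- A bounded derivation, from an ideal of regular operators generated by its positive
elements, to a dual Banach lattice module with left action `l` and right action `r`. All three
maps are extended linearly to the space of all bounded operators. -/
structure IsBoundedDualDerivation (A : Submodule ℝ (X →L[ℝ] X))
    (l r : (X →L[ℝ] X) →ₗ[ℝ] (𝔛 →L[ℝ] ℝ) →ₗ[ℝ] (𝔛 →L[ℝ] ℝ))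
    (D : (X →L[ℝ] X) →ₗ[ℝ] (𝔛 →L[ℝ] ℝ)) (K : ℝ) : Prop where
  const_nonneg : 0 ≤ K
  comp_mem_left : ∀ T ∈ LrSet X, ∀ a ∈ A, T ∘L a ∈ A
  comp_mem_right : ∀ a ∈ A, ∀ T ∈ LrSet X, a ∘L T ∈ A
  exists_pos_sub : ∀ a ∈ A, ∃ p ∈ A, ∃ q ∈ A, IsPosOp p ∧ IsPosOp q ∧ a = p - q
  left_comp : ∀ a ∈ A, ∀ b ∈ A, ∀ f, l (a ∘L b) f = l a (l b f)
  right_comp : ∀ a ∈ A, ∀ b ∈ A, ∀ f, r (a ∘L b) f = r b (r a f)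
  comm : ∀ a ∈ A, ∀ b ∈ A, ∀ f, l a (r b f) = r b (l a f)
  left_pos : ∀ a ∈ A, IsPosOp a → ∀ f, dualLe 0 f → dualLe 0 (l a f)
  right_pos : ∀ a ∈ A, IsPosOp a → ∀ f, dualLe 0 f → dualLe 0 (r a f)
  norm_left_le : ∀ a ∈ A, ∀ f, ‖l a f‖ ≤ K * rnorm a * ‖f‖
  norm_right_le : ∀ a ∈ A, ∀ f, ‖r a f‖ ≤ K * rnorm a * ‖f‖
  right_adjoint : ∀ a ∈ A, ∀ y, ∃ z, ∀ f, r a f y = f z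
  map_comp : ∀ a ∈ A, ∀ b ∈ A, D (a ∘L b) = l a (D b) + r b (D a)
  norm_le : ∀ a ∈ A, ‖D a‖ ≤ K * rnorm a

namespace IsBoundedDualDerivation

variable {A : Submodule ℝ (X →L[ℝ] X)}
  {l r : (X →L[ℝ] X) →ₗ[ℝ] (𝔛 →L[ℝ] ℝ) →ₗ[ℝ] (𝔛 →L[ℝ] ℝ)}
  {D : (X →L[ℝ] X) →ₗ[ℝ] (𝔛 →L[ℝ] ℝ)} {K : ℝ}
  {σ : X →L[ℝ] X} {x : ℕ → X} {s : ℕ → X →L[ℝ] ℝ}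

theorem left_mono (hD : IsBoundedDualDerivation A l r D K) {a : X →L[ℝ] X} (ha : a ∈ A)
    (hpos : IsPosOp a) {f g : 𝔛 →L[ℝ] ℝ} (h : dualLe f g) : dualLe (l a f) (l a g) := by
  rw [← dualLe_zero_sub, ← map_sub]
  exact hD.left_pos a ha hpos _ (dualLe_zero_sub.2 h)

theorem right_mono (hD : IsBoundedDualDerivation A l r D K) {a : X →L[ℝ] X} (ha : a ∈ A)
    (hpos : IsPosOp a) {f g : 𝔛 →L[ℝ] ℝ} (h : dualLe f g) : dualLe (r a f) (r a g) := by
  rw [← dualLe_zero_sub, ← map_sub]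
  exact hD.right_pos a ha hpos _ (dualLe_zero_sub.2 h)

theorem norm_left_le_of_le (hD : IsBoundedDualDerivation A l r D K) {a : X →L[ℝ] X} (ha : a ∈ A)
    {f : 𝔛 →L[ℝ] ℝ} {α β : ℝ} (hα : rnorm a ≤ α) (hβ : ‖f‖ ≤ β) : ‖l a f‖ ≤ K * α * β := by
  have := hD.const_nonneg
  have := (rnorm_nonneg a).trans hα
  exact (hD.norm_left_le a ha f).trans (by gcongr)

theorem norm_right_le_of_le (hD : IsBoundedDualDerivation A l r D K) {a : X →L[ℝ] X} (ha : a ∈ A)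
    {f : 𝔛 →L[ℝ] ℝ} {α β : ℝ} (hα : rnorm a ≤ α) (hβ : ‖f‖ ≤ β) : ‖r a f‖ ≤ K * α * β := by
  have := hD.const_nonneg
  have := (rnorm_nonneg a).trans hα
  exact (hD.norm_right_le a ha f).trans (by gcongr)

theorem norm_le_of_le (hD : IsBoundedDualDerivation A l r D K) {a : X →L[ℝ] X} (ha : a ∈ A)
    {α : ℝ} (hα : rnorm a ≤ α) : ‖D a‖ ≤ K * α :=
  (hD.norm_le a ha).trans (mul_le_mul_of_nonneg_left hα hD.const_nonneg)

theorem eproj_mem (hq : ∀ i, (s i).smulRight (x i) ∈ A) (n : ℕ) : eproj x s n ∈ A :=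
  A.sum_mem fun i _ => hq i

/-- The diagonal part of a derivation with respect to the right action. -/
theorem norm_sum_right_diagonal_le (hD : IsBoundedDualDerivation A l r D K)
    (h : IsPositiveBasis σ x s) (hq : ∀ i, (s i).smulRight (x i) ∈ A) {C : ℝ} (hC : ‖σ‖ ≤ C)
    (n : ℕ) :
    ‖∑ i ∈ Finset.range n, r ((s i).smulRight (x i)) (D ((s i).smulRight (x i)))‖ ≤
      K * C * (K * C) := by
  have := norm_add_sum_diagonal_le (r.compl₂ D) (fun i => (s i).smulRight (x i)) (K * C * (K * C))
    n 0 fun ε hε => by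
      have mem := A.sum_mem (t := Finset.range n) fun i _ => A.smul_mem (ε i) (hq i)
      have hr := (h.rnorm_signed_le n ε hε).trans hC
      rw [zero_add, LinearMap.compl₂_apply]
      exact hD.norm_right_le_of_le mem hr (hD.norm_le_of_le mem hr)
  simpa using this

/-- The diagonal part of a derivation with respect to the left action. -/
theorem norm_sum_left_diagonal_le (hD : IsBoundedDualDerivation A l r D K)
    (h : IsPositiveBasis σ x s) (hq : ∀ i, (s i).smulRight (x i) ∈ A) {C : ℝ} (hC : ‖σ‖ ≤ C)
    (n : ℕ) :
    ‖∑ i ∈ Finset.range n, l ((s i).smulRight (x i)) (D ((s i).smulRight (x i)))‖ ≤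
      K * C * (K * C) := by
  have := norm_add_sum_diagonal_le (l.compl₂ D) (fun i => (s i).smulRight (x i)) (K * C * (K * C))
    n 0 fun ε hε => by
      have mem := A.sum_mem (t := Finset.range n) fun i _ => A.smul_mem (ε i) (hq i)
      have hr := (h.rnorm_signed_le n ε hε).trans hC
      rw [zero_add, LinearMap.compl₂_apply]
      exact hD.norm_left_le_of_le mem hr (hD.norm_le_of_le mem hr)
  simpa using this

theorem map_matrix_entry (hD : IsBoundedDualDerivation A l r D K) (h : IsPositiveBasis σ x s)
    (hq : ∀ i, (s i).smulRight (x i) ∈ A) {a : X →L[ℝ] X} (ha : a ∈ A) (i j : ℕ) :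
    D ((s i).smulRight (x i) ∘L (a ∘L (s j).smulRight (x j))) =
      s i (a (x j)) • l ((s i).smulRight (x i)) (r ((s j).smulRight (x j))
        (D ((s j).smulRight (x i)))) +
      r (a ∘L (s j).smulRight (x j)) (r ((s i).smulRight (x i)) (D ((s i).smulRight (x i)))) +
      l ((s i).smulRight (x i) ∘L a) (l ((s j).smulRight (x j)) (D ((s j).smulRight (x j)))) := by
  set q : ℕ → X →L[ℝ] X := fun i => (s i).smulRight (x i) with hqdef
  have idem : ∀ k, q k ∘L q k = q k := fun k => by
    ext y
    simp [q, h.biorth]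
  have hL : ∀ k, q k ∈ LrSet X := fun k => (h.smulRight_pos k k).mem_LrSet
  have haq : a ∘L q j ∈ A := hD.comp_mem_right a ha _ (hL j)
  have hqa : q i ∘L a ∈ A := hD.comp_mem_left _ (hL i) a ha
  set w := q i ∘L (a ∘L q j) with hw
  have hwA : w ∈ A := hD.comp_mem_left _ (hL i) _ haq
  have e₁ : w = q i ∘L w := by rw [hw, ← ContinuousLinearMap.comp_assoc (q i) (q i), idem]
  have e₂ : w = w ∘L q j := by
    rw [hw, ContinuousLinearMap.comp_assoc, ContinuousLinearMap.comp_assoc, idem]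
  have e₃ : w = s i (a (x j)) • (s j).smulRight (x i) := by
    ext y
    simp [w, q, smul_smul, mul_comm]
  have d₁ : D w = l (q i) (D w) + r w (D (q i)) := by
    conv_lhs => rw [e₁]
    exact hD.map_comp _ (hq i) _ hwA
  have d₂ : D w = l w (D (q j)) + r (q j) (D w) := by
    conv_lhs => rw [e₂]
    exact hD.map_comp _ hwA _ (hq j)
  have f₁ : r w (D (q i)) = r (a ∘L q j) (r (q i) (D (q i))) := hD.right_comp _ (hq i) _ haq _
  have f₂ : l w (D (q j)) = l (q i ∘L a) (l (q j) (D (q j))) := by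
    rw [hw, ← ContinuousLinearMap.comp_assoc]
    exact hD.left_comp _ hqa _ (hq j) _
  have f₃ : l (q i) (l w (D (q j))) = l w (D (q j)) := by
    rw [← hD.left_comp _ (hq i) _ hwA, ← e₁]
  have f₄ : l (q i) (r (q j) (D w)) =
      s i (a (x j)) • l (q i) (r (q j) (D ((s j).smulRight (x i)))) := by
    rw [e₃]
    simp only [map_smul]
  change D w = _
  rw [d₁, d₂, map_add, f₃, f₄, f₁, f₂]
  abel

theorem comp_eproj (a : X →L[ℝ] X) (m : ℕ) :
    a ∘L eproj x s m = ∑ j ∈ Finset.range m, a ∘L (s j).smulRight (x j) := by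
  ext y
  simp [eproj, sum_apply]

theorem eproj_comp (a : X →L[ℝ] X) (n : ℕ) :
    eproj x s n ∘L a = ∑ i ∈ Finset.range n, (s i).smulRight (x i) ∘L a := by
  ext y
  simp [eproj, sum_apply]

theorem comp_finset_sum {ι : Type*} (b : X →L[ℝ] X) (t : Finset ι) (f : ι → X →L[ℝ] X) :
    b ∘L (∑ j ∈ t, f j) = ∑ j ∈ t, b ∘L f j := by
  ext y
  simp [sum_apply]

theorem map_eproj_comp (hD : IsBoundedDualDerivation A l r D K) (h : IsPositiveBasis σ x s)
    (hq : ∀ i, (s i).smulRight (x i) ∈ A) {a : X →L[ℝ] X} (ha : a ∈ A) (n m : ℕ) :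
    D (eproj x s n ∘L (a ∘L eproj x s m)) =
      (∑ i ∈ Finset.range n, ∑ j ∈ Finset.range m, s i (a (x j)) •
        l ((s i).smulRight (x i)) (r ((s j).smulRight (x j)) (D ((s j).smulRight (x i))))) +
      r (a ∘L eproj x s m)
        (∑ i ∈ Finset.range n, r ((s i).smulRight (x i)) (D ((s i).smulRight (x i)))) +
      l (eproj x s n ∘L a)
        (∑ j ∈ Finset.range m, l ((s j).smulRight (x j)) (D ((s j).smulRight (x j)))) := by
  rw [eproj_comp (a ∘L eproj x s m), comp_eproj a m, eproj_comp a n]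
  simp only [comp_finset_sum]
  rw [map_sum D, map_sum r, map_sum l, LinearMap.sum_apply, LinearMap.sum_apply]
  rw [Finset.sum_congr rfl fun i _ => (map_sum D _ _).trans
    (Finset.sum_congr rfl fun j _ => hD.map_matrix_entry h hq ha i j)]
  simp only [Finset.sum_add_distrib]
  congr 1
  · congr 1
    rw [Finset.sum_comm]
    exact Finset.sum_congr rfl fun j _ => (map_sum _ _ _).symm
  · exact Finset.sum_congr rfl fun j _ => (map_sum _ _ _).symm

end IsBoundedDualDerivation

end DerivationDomination

section DominatingMap

variable {X 𝔛 : Type*} [NormedAddCommGroup X] [Lattice X] [HasSolidNorm X] [IsOrderedAddMonoid X]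
  [NormedSpace ℝ X]
variable [NormedAddCommGroup 𝔛] [Lattice 𝔛] [HasSolidNorm 𝔛] [IsOrderedAddMonoid 𝔛]
  [NormedSpace ℝ 𝔛]

set_option linter.unusedSectionVars false

/-- A linear map which is positive as soon as `l` and `r` are and the functionals `v i j`, `f`
and `g` are positive. -/
noncomputable def matrixMap (l r : (X →L[ℝ] X) →ₗ[ℝ] (𝔛 →L[ℝ] ℝ) →ₗ[ℝ] (𝔛 →L[ℝ] ℝ))
    (x : ℕ → X) (s : ℕ → X →L[ℝ] ℝ) (v : ℕ → ℕ → 𝔛 →L[ℝ] ℝ) (f g : 𝔛 →L[ℝ] ℝ) (n m : ℕ) :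
    (X →L[ℝ] X) →ₗ[ℝ] (𝔛 →L[ℝ] ℝ) where
  toFun a := (∑ i ∈ Finset.range n, ∑ j ∈ Finset.range m, s i (a (x j)) •
      l ((s i).smulRight (x i)) (r ((s j).smulRight (x j)) (v i j))) +
    r (a ∘L eproj x s m) f + l (eproj x s n ∘L a) g
  map_add' a b := by
    simp only [add_apply, map_add, add_smul, Finset.sum_add_distrib,
      ContinuousLinearMap.add_comp, ContinuousLinearMap.comp_add, LinearMap.add_apply]
    abel
  map_smul' c a := by
    simp only [smul_apply, map_smul, smul_eq_mul, mul_smul, ContinuousLinearMap.smul_comp,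
      ContinuousLinearMap.comp_smul, LinearMap.smul_apply, RingHom.id_apply, smul_add,
      Finset.smul_sum]

namespace IsBoundedDualDerivation

variable {A : Submodule ℝ (X →L[ℝ] X)}
  {l r : (X →L[ℝ] X) →ₗ[ℝ] (𝔛 →L[ℝ] ℝ) →ₗ[ℝ] (𝔛 →L[ℝ] ℝ)}
  {D : (X →L[ℝ] X) →ₗ[ℝ] (𝔛 →L[ℝ] ℝ)} {K : ℝ}
  {σ : X →L[ℝ] X} {x : ℕ → X} {s : ℕ → X →L[ℝ] ℝ}

theorem corner_corner (hD : IsBoundedDualDerivation A l r D K) (h : IsPositiveBasis σ x s)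
    (hq : ∀ i, (s i).smulRight (x i) ∈ A) (i j i' j' : ℕ) (f : 𝔛 →L[ℝ] ℝ) :
    l ((s i).smulRight (x i)) (r ((s j).smulRight (x j))
      (l ((s i').smulRight (x i')) (r ((s j').smulRight (x j')) f))) =
    if i = i' ∧ j = j' then l ((s i).smulRight (x i)) (r ((s j).smulRight (x j)) f) else 0 := by
  have mul : ∀ k k', (s k).smulRight (x k) ∘L (s k').smulRight (x k') =
      if k = k' then (s k).smulRight (x k) else 0 := fun k k' => by
    split_ifs with hk
    · subst hk; ext y; simp [h.biorth]
    · ext y; simp [h.biorth, hk]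
  rw [hD.comm _ (hq i') _ (hq j'), ← hD.right_comp _ (hq j') _ (hq j),
    hD.comm _ (hq i) _ (hD.comp_mem_left _ (h.smulRight_pos j' j').mem_LrSet _ (hq j)),
    ← hD.left_comp _ (hq i) _ (hq i'), mul, mul]
  by_cases hi : i = i'
  · by_cases hj : j = j'
    · subst hi hj
      simp [hD.comm _ (hq i) _ (hq j)]
    · simp [hj, Ne.symm hj]
  · simp [hi]

/-- The compressions of a bounded derivation to the spans of initial segments of a positive
shrinking basis are dominated on the positive cone by positive maps, with uniform bounds. -/
theorem exists_dominating_map (hD : IsBoundedDualDerivation A l r D K)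
    (h : IsPositiveBasis σ x s) (hq : ∀ i, (s i).smulRight (x i) ∈ A) {C : ℝ} (hC : ‖σ‖ ≤ C)
    (n m : ℕ) :
    ∃ Q : (X →L[ℝ] X) →ₗ[ℝ] (𝔛 →L[ℝ] ℝ), ∀ a ∈ A, IsPosOp a →
      dualLe 0 (Q a) ∧ dualLe (D (eproj x s n ∘L (a ∘L eproj x s m))) (Q a) ∧
      ‖Q a‖ ≤ K * C * (K * C * (K * (C * (‖a‖ * C)) + K * (‖a‖ * C) * (K * C * (K * C)) +
          K * (C * ‖a‖) * (K * C * (K * C)))) +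
        K * (‖a‖ * C) * (K * C * (K * C)) + K * (C * ‖a‖) * (K * C * (K * C)) := by
  set q : ℕ → X →L[ℝ] X := fun i => (s i).smulRight (x i) with hqdef
  set v : ℕ → ℕ → 𝔛 →L[ℝ] ℝ := fun i j => l (q i) (r (q j) (D ((s j).smulRight (x i)))) with hv
  set Ξ := ∑ i ∈ Finset.range n, r (q i) (D (q i)) with hΞ
  set Ξ' := ∑ j ∈ Finset.range m, l (q j) (D (q j)) with hΞ'
  have hΞn : ‖dualPos Ξ‖ ≤ K * C * (K * C) :=
    (norm_dualPos_le _).trans (hD.norm_sum_right_diagonal_le h hq hC n)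
  have hΞn' : ‖dualPos Ξ'‖ ≤ K * C * (K * C) :=
    (norm_dualPos_le _).trans (hD.norm_sum_left_diagonal_le h hq hC m)
  refine ⟨matrixMap l r x s (fun i j => dualPos (v i j)) (dualPos Ξ) (dualPos Ξ') n m,
    fun a ha hpos => ?_⟩
  have hC0 : 0 ≤ C := (norm_nonneg σ).trans hC
  have qpos : ∀ i, IsPosOp (q i) := fun i => h.smulRight_pos i i
  have vq : ∀ i j, l (q i) (r (q j) (v i j)) = v i j := fun i j => by
    simpa using hD.corner_corner h hq i j i j (D ((s j).smulRight (x i)))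
  have apos : ∀ i j, 0 ≤ s i (a (x j)) := fun i j =>
    h.coeff_nonneg i _ (hpos _ (h.vec_nonneg j))
  have aem : a ∘L eproj x s m ∈ A := hD.comp_mem_right a ha _ (h.eproj_pos m).mem_LrSet
  have ena : eproj x s n ∘L a ∈ A := hD.comp_mem_left _ (h.eproj_pos n).mem_LrSet a ha
  have aem_pos : IsPosOp (a ∘L eproj x s m) := hpos.comp (h.eproj_pos m)
  have ena_pos : IsPosOp (eproj x s n ∘L a) := (h.eproj_pos n).comp hpos
  have eaem : eproj x s n ∘L (a ∘L eproj x s m) ∈ A :=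
    hD.comp_mem_left _ (h.eproj_pos n).mem_LrSet _ aem
  have en_le := (h.norm_eproj_le n).trans hC
  have em_le := (h.norm_eproj_le m).trans hC
  have naem : ‖a ∘L eproj x s m‖ ≤ ‖a‖ * C :=
    (ContinuousLinearMap.opNorm_comp_le _ _).trans (by gcongr)
  have nena : ‖eproj x s n ∘L a‖ ≤ C * ‖a‖ :=
    (ContinuousLinearMap.opNorm_comp_le _ _).trans (by gcongr)
  have neaem : ‖eproj x s n ∘L (a ∘L eproj x s m)‖ ≤ C * (‖a‖ * C) :=
    (ContinuousLinearMap.opNorm_comp_le _ _).trans (by gcongr)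
  have raem := aem_pos.rnorm_le.trans naem
  have rena := ena_pos.rnorm_le.trans nena
  have reaem := ((h.eproj_pos n).comp aem_pos).rnorm_le.trans neaem
  have corner_pos : ∀ i j, ∀ f, dualLe 0 f → dualLe 0 (l (q i) (r (q j) f)) := fun i j f hf =>
    hD.left_pos _ (hq i) (qpos i) _ (hD.right_pos _ (hq j) (qpos j) _ hf)
  have corner_mono : ∀ i j, ∀ f g, dualLe f g →
      dualLe (l (q i) (r (q j) f)) (l (q i) (r (q j) g)) := fun i j f g hfg =>
    hD.left_mono (hq i) (qpos i) (hD.right_mono (hq j) (qpos j) hfg)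
  have t₂ := hD.right_pos _ aem aem_pos _ (dualPos_nonneg Ξ)
  have t₃ := hD.left_pos _ ena ena_pos _ (dualPos_nonneg Ξ')
  set T := ∑ i ∈ Finset.range n, ∑ j ∈ Finset.range m, s i (a (x j)) •
        l (q i) (r (q j) (dualPos (v i j))) with hT
  have t₁ : dualLe 0 T := fun y hy => by
    simp only [T, sum_apply, smul_apply, zero_apply]
    exact Finset.sum_nonneg fun i _ => Finset.sum_nonneg fun j _ =>
      mul_nonneg (apos i j) (corner_pos i j _ (dualPos_nonneg _) y hy)
  have Dform := hD.map_eproj_comp h hq ha n m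
  set H := ∑ i ∈ Finset.range n, ∑ j ∈ Finset.range m, s i (a (x j)) • v i j with hH
  have Dform' : D (eproj x s n ∘L (a ∘L eproj x s m)) =
      H + r (a ∘L eproj x s m) Ξ + l (eproj x s n ∘L a) Ξ' := Dform
  have tH : dualLe H T := dualLe.sum fun i _ => dualLe.sum fun j _ => by
    rw [← vq i j]
    exact (corner_mono i j _ _ (by rw [vq]; exact le_dualPos _)).smul (apos i j)
  have Qform : matrixMap l r x s (fun i j => dualPos (v i j)) (dualPos Ξ) (dualPos Ξ') n m a =
      T + r (a ∘L eproj x s m) (dualPos Ξ) + l (eproj x s n ∘L a) (dualPos Ξ') := rfl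
  refine ⟨?_, ?_, ?_⟩
  · rw [Qform]
    simpa using (t₁.add t₂).add t₃
  · rw [Qform, Dform']
    exact (tH.add (hD.right_mono aem aem_pos (le_dualPos _))).add
      (hD.left_mono ena ena_pos (le_dualPos _))
  · have Hn : ‖H‖ ≤ K * (C * (‖a‖ * C)) + K * (‖a‖ * C) * (K * C * (K * C)) +
          K * (C * ‖a‖) * (K * C * (K * C)) := by
      have : H = D (eproj x s n ∘L (a ∘L eproj x s m)) - r (a ∘L eproj x s m) Ξ -
          l (eproj x s n ∘L a) Ξ' := by rw [Dform']; abel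
      rw [this]
      refine (norm_sub_le _ _).trans (add_le_add ((norm_sub_le _ _).trans (add_le_add ?_ ?_)) ?_)
      · exact hD.norm_le_of_le eaem reaem
      · exact hD.norm_right_le_of_le aem raem (hD.norm_sum_right_diagonal_le h hq hC n)
      · exact hD.norm_left_le_of_le ena rena (hD.norm_sum_left_diagonal_le h hq hC m)
    have corner_H : ∀ i ∈ Finset.range n, ∀ j ∈ Finset.range m,
        l (q i) (r (q j) H) = s i (a (x j)) • v i j := by
      intro i hi j hj
      simp only [hH, map_sum, map_smul]
      rw [Finset.sum_eq_single_of_mem i hi, Finset.sum_eq_single_of_mem j hj]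
      · rw [vq]
      · intro j' _ hj'
        rw [show l (q i) (r (q j) (v i j')) = 0 by
          rw [hD.corner_corner h hq i j i j', if_neg fun e => hj' e.2.symm], smul_zero]
      · intro i' _ hi'
        refine Finset.sum_eq_zero fun j' _ => ?_
        rw [show l (q i) (r (q j) (v i' j')) = 0 by
          rw [hD.corner_corner h hq i j i' j', if_neg fun e => hi' e.1.symm], smul_zero]
    have T_le : dualLe T (l (eproj x s n) (r (eproj x s m) (dualPos H))) := by
      have expand : l (eproj x s n) (r (eproj x s m) (dualPos H)) =
          ∑ i ∈ Finset.range n, ∑ j ∈ Finset.range m, l (q i) (r (q j) (dualPos H)) := by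
        simp only [eproj, map_sum, LinearMap.sum_apply]
        exact Finset.sum_comm
      rw [expand]
      refine dualLe.sum fun i hi => dualLe.sum fun j hj => ?_
      rcases (apos i j).eq_or_lt with h0 | h0
      · rw [← h0, zero_smul]
        exact corner_pos i j _ (dualPos_nonneg _)
      · have hle : dualLe (v i j) ((s i (a (x j)))⁻¹ • l (q i) (r (q j) (dualPos H))) := by
          have := (corner_mono i j _ _ (le_dualPos H)).smul (inv_nonneg.2 h0.le)
          rwa [corner_H i hi j hj, inv_smul_smul₀ h0.ne'] at this
        have hpos' : dualLe 0 ((s i (a (x j)))⁻¹ • l (q i) (r (q j) (dualPos H))) := by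
          simpa using (corner_pos i j _ (dualPos_nonneg H)).smul (inv_nonneg.2 h0.le)
        have := (corner_mono i j _ _ (dualPos_le hpos' hle)).smul h0.le
        simp only [map_smul, smul_inv_smul₀ h0.ne'] at this
        rwa [hD.corner_corner h hq i j i j, if_pos ⟨rfl, rfl⟩] at this
    have Tn : ‖T‖ ≤ K * C * (K * C * (K * (C * (‖a‖ * C)) + K * (‖a‖ * C) * (K * C * (K * C)) +
          K * (C * ‖a‖) * (K * C * (K * C)))) :=
      (norm_le_of_dualLe t₁ T_le).trans
        (hD.norm_left_le_of_le (eproj_mem hq n) ((h.rnorm_eproj_le n).trans hC)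
          (hD.norm_right_le_of_le (eproj_mem hq m) ((h.rnorm_eproj_le m).trans hC)
            ((norm_dualPos_le _).trans Hn)))
    rw [Qform]
    exact (norm_add_le _ _).trans (add_le_add ((norm_add_le _ _).trans (add_le_add Tn
      (hD.norm_right_le_of_le aem raem hΞn))) (hD.norm_left_le_of_le ena rena hΞn'))

end IsBoundedDualDerivation

end DominatingMap

section SliceLimits

variable {X 𝔛 : Type*} [NormedAddCommGroup X] [Lattice X] [HasSolidNorm X] [IsOrderedAddMonoid X]
  [NormedSpace ℝ X]
variable [NormedAddCommGroup 𝔛] [Lattice 𝔛] [HasSolidNorm 𝔛] [IsOrderedAddMonoid 𝔛]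
  [NormedSpace ℝ 𝔛]

set_option linter.unusedSectionVars false

namespace IsBoundedDualDerivation

variable {A : Submodule ℝ (X →L[ℝ] X)}
  {l r : (X →L[ℝ] X) →ₗ[ℝ] (𝔛 →L[ℝ] ℝ) →ₗ[ℝ] (𝔛 →L[ℝ] ℝ)}
  {D : (X →L[ℝ] X) →ₗ[ℝ] (𝔛 →L[ℝ] ℝ)} {K : ℝ}
  {σ : X →L[ℝ] X} {x : ℕ → X} {s : ℕ → X →L[ℝ] ℝ}

theorem comp_proj {b : X →L[ℝ] X} (hσ : σ ∘L σ = σ) (hb : σ ∘L (b ∘L σ) = b) : b ∘L σ = b := by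
  rw [← hb, ContinuousLinearMap.comp_assoc, ContinuousLinearMap.comp_assoc, hσ]

theorem compression_mem_ASigma (hD : IsBoundedDualDerivation A l r D K) (hpos : IsPosOp σ)
    (hσ : σ ∘L σ = σ) {a : X →L[ℝ] X} (ha : a ∈ A) :
    σ ∘L (a ∘L σ) ∈ ASigma (A : Set (X →L[ℝ] X)) σ := by
  refine ⟨hD.comp_mem_left _ hpos.mem_LrSet _ (hD.comp_mem_right _ ha _ hpos.mem_LrSet), ?_⟩
  ext y
  have := fun z => congrArg (fun T : X →L[ℝ] X => T z) hσ
  simp only [ContinuousLinearMap.comp_apply] at this ⊢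
  rw [this, this]

theorem exists_pos_sub_ASigma (hD : IsBoundedDualDerivation A l r D K) (hpos : IsPosOp σ)
    (hσ : σ ∘L σ = σ) {a : X →L[ℝ] X} (ha : a ∈ ASigma (A : Set (X →L[ℝ] X)) σ) :
    ∃ p ∈ ASigma (A : Set (X →L[ℝ] X)) σ, ∃ q ∈ ASigma (A : Set (X →L[ℝ] X)) σ,
      IsPosOp p ∧ IsPosOp q ∧ a = p - q := by
  obtain ⟨p, hp, q, hq, hp0, hq0, hpq⟩ := hD.exists_pos_sub a ha.1
  refine ⟨_, hD.compression_mem_ASigma hpos hσ hp, _, hD.compression_mem_ASigma hpos hσ hq,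
    hpos.comp (hp0.comp hpos), hpos.comp (hq0.comp hpos), ?_⟩
  rw [← ha.2, hpq]
  ext y
  simp

theorem monotone_left_eproj (hD : IsBoundedDualDerivation A l r D K)
    (h : IsPositiveBasis σ x s) (hq : ∀ i, (s i).smulRight (x i) ∈ A) {f : 𝔛 →L[ℝ] ℝ}
    (hf : dualLe 0 f) {n m : ℕ} (hnm : n ≤ m) :
    dualLe (l (eproj x s n) f) (l (eproj x s m) f) := by
  rw [← dualLe_zero_sub, ← LinearMap.sub_apply, ← map_sub l]
  exact hD.left_pos _ (A.sub_mem (eproj_mem hq m) (eproj_mem hq n)) (h.eproj_sub_pos hnm) _ hf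

theorem monotone_right_eproj (hD : IsBoundedDualDerivation A l r D K)
    (h : IsPositiveBasis σ x s) (hq : ∀ i, (s i).smulRight (x i) ∈ A) {f : 𝔛 →L[ℝ] ℝ}
    (hf : dualLe 0 f) {n m : ℕ} (hnm : n ≤ m) :
    dualLe (r (eproj x s n) f) (r (eproj x s m) f) := by
  rw [← dualLe_zero_sub, ← LinearMap.sub_apply, ← map_sub r]
  exact hD.right_pos _ (A.sub_mem (eproj_mem hq m) (eproj_mem hq n)) (h.eproj_sub_pos hnm) _ hf

theorem tendsto_left_eproj (hD : IsBoundedDualDerivation A l r D K)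
    (h : IsPositiveBasis σ x s) (hσ : σ ∘L σ = σ) (hq : ∀ i, (s i).smulRight (x i) ∈ A)
    (hsup : ∀ a ∈ ASigma (A : Set (X →L[ℝ] X)) σ, IsPosOp a → ∀ f, dualLe 0 f →
      dualIsLUB (Set.range fun n => l (eproj x s n) (l a f)) (l a f))
    {a : X →L[ℝ] X} (ha : a ∈ ASigma (A : Set (X →L[ℝ] X)) σ) (f : 𝔛 →L[ℝ] ℝ) (y : 𝔛) :
    Tendsto (fun n => l (eproj x s n) (l a f) y) atTop (𝓝 (l a f y)) := by
  have pos : ∀ p ∈ ASigma (A : Set (X →L[ℝ] X)) σ, IsPosOp p → ∀ g, dualLe 0 g →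
      Tendsto (fun n => l (eproj x s n) (l p g) y) atTop (𝓝 (l p g y)) := fun p hp hp0 g hg => by
    have hpg := hD.left_pos p hp.1 hp0 g hg
    exact tendsto_of_dualIsLUB (fun n m hnm => hD.monotone_left_eproj h hq hpg hnm)
      (fun n => hD.left_pos _ (eproj_mem hq n) (h.eproj_pos n) _ hpg) (hsup p hp hp0 g hg) y
  obtain ⟨p, hp, p', hp', hp0, hp0', rfl⟩ := hD.exists_pos_sub_ASigma h.proj_pos hσ ha
  obtain ⟨g, g', hg, hg', rfl⟩ := exists_dual_sub f
  simpa using ((pos p hp hp0 g hg).sub (pos p hp hp0 g' hg')).sub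
    ((pos p' hp' hp0' g hg).sub (pos p' hp' hp0' g' hg'))

theorem tendsto_right_eproj (hD : IsBoundedDualDerivation A l r D K)
    (h : IsPositiveBasis σ x s) (hσ : σ ∘L σ = σ) (hq : ∀ i, (s i).smulRight (x i) ∈ A)
    (hsup : ∀ a ∈ ASigma (A : Set (X →L[ℝ] X)) σ, IsPosOp a → ∀ f, dualLe 0 f →
      dualIsLUB (Set.range fun n => r (eproj x s n) (r a f)) (r a f))
    {a : X →L[ℝ] X} (ha : a ∈ ASigma (A : Set (X →L[ℝ] X)) σ) (f : 𝔛 →L[ℝ] ℝ) (y : 𝔛) :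
    Tendsto (fun n => r (eproj x s n) (r a f) y) atTop (𝓝 (r a f y)) := by
  have pos : ∀ p ∈ ASigma (A : Set (X →L[ℝ] X)) σ, IsPosOp p → ∀ g, dualLe 0 g →
      Tendsto (fun n => r (eproj x s n) (r p g) y) atTop (𝓝 (r p g y)) := fun p hp hp0 g hg => by
    have hpg := hD.right_pos p hp.1 hp0 g hg
    exact tendsto_of_dualIsLUB (fun n m hnm => hD.monotone_right_eproj h hq hpg hnm)
      (fun n => hD.right_pos _ (eproj_mem hq n) (h.eproj_pos n) _ hpg) (hsup p hp hp0 g hg) y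
  obtain ⟨p, hp, p', hp', hp0, hp0', rfl⟩ := hD.exists_pos_sub_ASigma h.proj_pos hσ ha
  obtain ⟨g, g', hg, hg', rfl⟩ := exists_dual_sub f
  simpa using ((pos p hp hp0 g hg).sub (pos p hp hp0 g' hg')).sub
    ((pos p' hp' hp0' g hg).sub (pos p' hp' hp0' g' hg'))

/-- Compressing an element of a factorable slice from the left by the basis projections does not
change the derivation in the limit along an ultrafilter. -/
theorem tendsto_map_eproj_comp (hD : IsBoundedDualDerivation A l r D K)
    (h : IsPositiveBasis σ x s) (hq : ∀ i, (s i).smulRight (x i) ∈ A)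
    (hl : ∀ a ∈ ASigma (A : Set (X →L[ℝ] X)) σ, ∀ f y,
      Tendsto (fun n => l (eproj x s n) (l a f) y) atTop (𝓝 (l a f y)))
    (hr : ∀ a ∈ ASigma (A : Set (X →L[ℝ] X)) σ, ∀ f y,
      Tendsto (fun n => r (eproj x s n) (r a f) y) atTop (𝓝 (r a f y)))
    {c d : X →L[ℝ] X} (hc : c ∈ ASigma (A : Set (X →L[ℝ] X)) σ)
    (hd : d ∈ ASigma (A : Set (X →L[ℝ] X)) σ) (U : Ultrafilter ℕ) (hU : ↑U ≤ (atTop : Filter ℕ))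
    (y : 𝔛) :
    Tendsto (fun n => D (eproj x s n ∘L (c ∘L d)) y) U (𝓝 (D (c ∘L d) y)) := by
  have e : ∀ n, eproj x s n ∈ A := eproj_mem hq
  have eL : ∀ n, eproj x s n ∈ LrSet X := fun n => (h.eproj_pos n).mem_LrSet
  have ec : ∀ n, eproj x s n ∘L c ∈ A := fun n => hD.comp_mem_left _ (eL n) _ hc.1
  have de : ∀ n, d ∘L eproj x s n ∈ A := fun n => hD.comp_mem_right _ hd.1 _ (eL n)
  have ce : ∀ n, c ∘L eproj x s n ∈ A := fun n => hD.comp_mem_right _ hc.1 _ (eL n)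
  set u : ℕ → 𝔛 →L[ℝ] ℝ := fun n => D c - D (eproj x s n ∘L c) with hu
  obtain ⟨p, hp, p', hp', hp0, hp0', hpp'⟩ := hD.exists_pos_sub c hc.1
  have bound_pos : ∀ p ∈ A, IsPosOp p → ∀ n, ‖D (eproj x s n ∘L p)‖ ≤ K * (‖σ‖ * ‖p‖) :=
    fun p hp hp0 n => hD.norm_le_of_le (hD.comp_mem_left _ (eL n) _ hp)
      (((h.eproj_pos n).comp hp0).rnorm_le.trans ((ContinuousLinearMap.opNorm_comp_le _ _).trans
        (mul_le_mul_of_nonneg_right (h.norm_eproj_le n) (norm_nonneg p))))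
  have bound : ∀ n, ‖u n‖ ≤ ‖D c‖ + (K * (‖σ‖ * ‖p‖) + K * (‖σ‖ * ‖p'‖)) := fun n => by
    refine (norm_sub_le _ _).trans (add_le_add_right ?_ _)
    rw [hpp', ContinuousLinearMap.comp_sub, map_sub D]
    exact (norm_sub_le _ _).trans (add_le_add (bound_pos p hp hp0 n) (bound_pos p' hp' hp0' n))
  obtain ⟨τ, hτ⟩ := exists_ultrafilter_dual_limit U u _ bound
  have right_lim : ∀ a ∈ A, ∀ y, Tendsto (fun n => r a (u n) y) U (𝓝 (r a τ y)) := by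
    intro a ha y
    obtain ⟨z, hz⟩ := hD.right_adjoint a ha y
    simpa only [hz] using hτ z
  have right_eproj : ∀ k, r (eproj x s k) τ = 0 := by
    intro k
    ext y
    refine tendsto_nhds_unique (right_lim _ (e k) y) ?_
    set w := D (eproj x s k) with hw
    have eq : ∀ n, r (eproj x s k) (u n) =
        D (c ∘L eproj x s k - eproj x s n ∘L (c ∘L eproj x s k)) -
          (l c w - l (eproj x s n) (l c w)) := fun n => by
      rw [map_sub D, hD.map_comp _ hc.1 _ (e k), ← ContinuousLinearMap.comp_assoc,
        hD.map_comp _ (ec n) _ (e k), hD.left_comp _ (e n) _ hc.1, hu, map_sub]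
      abel
    have lim₁ : Tendsto (fun n => D (c ∘L eproj x s k - eproj x s n ∘L (c ∘L eproj x s k)) y)
        atTop (𝓝 0) := by
      have : Tendsto (fun n => K * rnorm (c ∘L eproj x s k - eproj x s n ∘L (c ∘L eproj x s k)) *
          ‖y‖) atTop (𝓝 0) := by
        simpa using ((h.tendsto_rnorm_left hc.2 k).const_mul K).mul_const ‖y‖
      refine squeeze_zero_norm (fun n => ?_) this
      refine (ContinuousLinearMap.le_opNorm _ _).trans (mul_le_mul_of_nonneg_right ?_
        (norm_nonneg y))
      exact hD.norm_le _ (A.sub_mem (ce k) (hD.comp_mem_left _ (eL n) _ (ce k)))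
    have lim₂ := (tendsto_const_nhds (x := l c w y)).sub (hl c hc w y)
    have := (lim₁.sub lim₂).mono_left hU
    simp only [sub_self] at this
    refine this.congr fun n => ?_
    rw [eq]
    rfl
  have right_comp_eproj : ∀ m, r (d ∘L eproj x s m) τ = 0 := by
    intro m
    have zero : ∀ k, r (eproj x s k ∘L (d ∘L eproj x s m)) τ = 0 := fun k => by
      rw [hD.right_comp _ (e k) _ (de m), right_eproj, map_zero]
    have lim : Tendsto (fun k =>
        K * rnorm (d ∘L eproj x s m - eproj x s k ∘L (d ∘L eproj x s m)) * ‖τ‖) atTop (𝓝 0) := by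
      simpa using ((h.tendsto_rnorm_left hd.2 m).const_mul K).mul_const ‖τ‖
    refine norm_le_zero_iff.1 (ge_of_tendsto' lim fun k => ?_)
    have := hD.norm_right_le _ (A.sub_mem (de m) (hD.comp_mem_left _ (eL k) _ (de m))) τ
    rwa [map_sub, LinearMap.sub_apply, zero, sub_zero] at this
  have right_zero : r d τ = 0 := by
    ext y
    refine tendsto_nhds_unique (hr d hd τ y) ?_
    have : ∀ m, r (eproj x s m) (r d τ) = 0 := fun m => by
      rw [← hD.right_comp _ hd.1 _ (e m), right_comp_eproj]
    simp only [this]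
    exact tendsto_const_nhds
  have eq : ∀ n, D (eproj x s n ∘L (c ∘L d)) y =
      l (eproj x s n) (l c (D d)) y + r d (D c) y - r d (u n) y := fun n => by
    rw [← ContinuousLinearMap.comp_assoc, hD.map_comp _ (ec n) _ hd.1,
      hD.left_comp _ (e n) _ hc.1, hu, map_sub]
    simp only [add_apply, sub_apply]
    ring
  have lim := ((((hl c hc (D d) y).mono_left hU).add (tendsto_const_nhds (x := r d (D c) y))).sub
    (right_lim d hd.1 y))
  rw [right_zero] at lim
  rw [hD.map_comp _ hc.1 _ hd.1]
  simpa [eq] using lim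

theorem tendsto_map_comp_eproj (hD : IsBoundedDualDerivation A l r D K)
    (h : IsPositiveBasis σ x s) {b : X →L[ℝ] X} (hb : b ∈ A) (hbσ : b ∘L σ = b) (n : ℕ) (y : 𝔛) :
    Tendsto (fun m => D (eproj x s n ∘L (b ∘L eproj x s m)) y) atTop
      (𝓝 (D (eproj x s n ∘L b) y)) := by
  have eL : ∀ n, eproj x s n ∈ LrSet X := fun n => (h.eproj_pos n).mem_LrSet
  have lim : Tendsto (fun m => K * rnorm (eproj x s n ∘L b - eproj x s n ∘L (b ∘L eproj x s m)) *
      ‖y‖) atTop (𝓝 0) := by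
    simpa using ((h.tendsto_rnorm_right hbσ n).const_mul K).mul_const ‖y‖
  have : Tendsto (fun m => D (eproj x s n ∘L b - eproj x s n ∘L (b ∘L eproj x s m)) y) atTop
      (𝓝 0) := by
    refine squeeze_zero_norm (fun m => ?_) lim
    refine (ContinuousLinearMap.le_opNorm _ _).trans (mul_le_mul_of_nonneg_right ?_
      (norm_nonneg y))
    exact hD.norm_le _ (A.sub_mem (hD.comp_mem_left _ (eL n) _ hb)
      (hD.comp_mem_left _ (eL n) _ (hD.comp_mem_right _ hb _ (eL m))))
  simpa using (tendsto_const_nhds (x := D (eproj x s n ∘L b) y)).sub this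

end IsBoundedDualDerivation

end SliceLimits

section Assembly

variable {X 𝔛 : Type*} [NormedAddCommGroup X] [Lattice X] [HasSolidNorm X] [IsOrderedAddMonoid X]
  [NormedSpace ℝ X]
variable [NormedAddCommGroup 𝔛] [Lattice 𝔛] [HasSolidNorm 𝔛] [IsOrderedAddMonoid 𝔛]
  [NormedSpace ℝ 𝔛]

set_option linter.unusedSectionVars false

theorem tendsto_bind_nhds {α β γ : Type*} [TopologicalSpace γ] {f : Filter α}
    {g : α → Filter β} {F : β → γ} {G : α → γ} {L : γ} (hG : Tendsto G f (𝓝 L))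
    (hF : ∀ a, Tendsto F (g a) (𝓝 (G a))) : Tendsto F (f.bind g) (𝓝 L) := by
  refine tendsto_nhds.2 fun s hs hL => mem_bind'.2 ?_
  filter_upwards [hG (hs.mem_nhds hL)] with a ha
  exact hF a (hs.mem_nhds ha)

theorem piFilter_neBot {P : Set (X →L[ℝ] X)} (hne : P.Nonempty)
    (hdir : ∀ σ₁ ∈ P, ∀ σ₂ ∈ P, ∃ σ₃ ∈ P,
      Set.range ⇑σ₁ ⊆ Set.range ⇑σ₃ ∧ Set.range ⇑σ₂ ⊆ Set.range ⇑σ₃) :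
    (piFilter P).NeBot := by
  have : Nonempty {σ : X →L[ℝ] X // σ ∈ P} := hne.to_subtype
  refine iInf_neBot_of_directed' (fun σ₁ σ₂ => ?_) fun σ =>
    principal_neBot_iff.2 ⟨σ, Set.Subset.rfl⟩
  obtain ⟨σ₃, h₃, h₁₃, h₂₃⟩ := hdir σ₁ σ₁.2 σ₂ σ₂.2
  exact ⟨⟨σ₃, h₃⟩, principal_mono.2 fun τ hτ => h₁₃.trans hτ,
    principal_mono.2 fun τ hτ => h₂₃.trans hτ⟩

theorem exists_isBoundedDualDerivation {A : Set (X →L[ℝ] X)} (hA0 : 0 ∈ A)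
    (hAsub : A ⊆ LrSet X)
    (hAadd : ∀ a ∈ A, ∀ b ∈ A, a + b ∈ A)
    (hAsmul : ∀ (c : ℝ), ∀ a ∈ A, c • a ∈ A)
    (hAideal : ∀ a ∈ A, ∀ T ∈ LrSet X, T ∘L a ∈ A ∧ a ∘L T ∈ A)
    (hARiesz : ∀ a ∈ A, ∃ m ∈ A, opLe a m ∧ opLe (-a) m ∧
      ∀ c ∈ LrSet X, opLe a c → opLe (-a) c → opLe m c)
    {Ml Mr : (X →L[ℝ] X) → 𝔛 → 𝔛} {M : ℝ}
    (hMllin : ∀ a ∈ A, ∀ b ∈ A, ∀ (s t : ℝ) (y : 𝔛),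
      Ml (s • a + t • b) y = s • Ml a y + t • Ml b y)
    (hMrlin : ∀ a ∈ A, ∀ b ∈ A, ∀ (s t : ℝ) (y : 𝔛),
      Mr (s • a + t • b) y = s • Mr a y + t • Mr b y)
    (hMlmul : ∀ a ∈ A, ∀ b ∈ A, ∀ y : 𝔛, Ml (a ∘L b) y = Ml a (Ml b y))
    (hMrmul : ∀ a ∈ A, ∀ b ∈ A, ∀ y : 𝔛, Mr (a ∘L b) y = Mr b (Mr a y))
    (hMlr : ∀ a ∈ A, ∀ b ∈ A, ∀ y : 𝔛, Ml a (Mr b y) = Mr b (Ml a y))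
    (hMpos : ∀ a ∈ A, IsPosOp a → ∀ y : 𝔛, 0 ≤ y → 0 ≤ Ml a y ∧ 0 ≤ Mr a y)
    (hMbd : ∀ a ∈ A, ∀ y : 𝔛, ‖Ml a y‖ ≤ M * rnorm a * ‖y‖ ∧ ‖Mr a y‖ ≤ M * rnorm a * ‖y‖)
    {DL DR : (X →L[ℝ] X) → (𝔛 →L[ℝ] ℝ) → (𝔛 →L[ℝ] ℝ)}
    (hDL : ∀ a ∈ A, ∀ (x' : 𝔛 →L[ℝ] ℝ) (y : 𝔛), DL a x' y = x' (Mr a y))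
    (hDR : ∀ a ∈ A, ∀ (x' : 𝔛 →L[ℝ] ℝ) (y : 𝔛), DR a x' y = x' (Ml a y))
    {D : (X →L[ℝ] X) → (𝔛 →L[ℝ] ℝ)}
    (hDadd : ∀ a ∈ A, ∀ b ∈ A, D (a + b) = D a + D b)
    (hDsmul : ∀ (r : ℝ), ∀ a ∈ A, D (r • a) = r • D a)
    (hDder : ∀ a ∈ A, ∀ b ∈ A, D (a ∘L b) = DL a (D b) + DR b (D a))
    (hDbdd : ∃ C : ℝ, ∀ a ∈ A, ‖D a‖ ≤ C * rnorm a) :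
    ∃ (B : Submodule ℝ (X →L[ℝ] X)) (l r : (X →L[ℝ] X) →ₗ[ℝ] (𝔛 →L[ℝ] ℝ) →ₗ[ℝ] (𝔛 →L[ℝ] ℝ))
      (d : (X →L[ℝ] X) →ₗ[ℝ] (𝔛 →L[ℝ] ℝ)) (K : ℝ), IsBoundedDualDerivation B l r d K ∧
      (B : Set (X →L[ℝ] X)) = A ∧ (∀ a ∈ A, ∀ f, l a f = DL a f) ∧
      (∀ a ∈ A, ∀ f, r a f = DR a f) ∧ ∀ a ∈ A, d a = D a := by
  obtain ⟨C, hC⟩ := hDbdd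
  let B : Submodule ℝ (X →L[ℝ] X) :=
    { carrier := A
      zero_mem' := hA0
      add_mem' := fun ha hb => hAadd _ ha _ hb
      smul_mem' := fun c _ ha => hAsmul c _ ha }
  have linear_extension : ∀ (N : (X →L[ℝ] X) → 𝔛 → 𝔛)
      (_ : ∀ a ∈ A, ∀ b ∈ A, ∀ (s t : ℝ) (y : 𝔛), N (s • a + t • b) y = s • N a y + t • N b y)
      (F : (X →L[ℝ] X) → (𝔛 →L[ℝ] ℝ) → (𝔛 →L[ℝ] ℝ))
      (_ : ∀ a ∈ A, ∀ (x' : 𝔛 →L[ℝ] ℝ) (y : 𝔛), F a x' y = x' (N a y)),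
      ∃ l : (X →L[ℝ] X) →ₗ[ℝ] (𝔛 →L[ℝ] ℝ) →ₗ[ℝ] (𝔛 →L[ℝ] ℝ), ∀ a ∈ A, ∀ f, l a f = F a f := by
    intro N hN F hF
    let φ : B →ₗ[ℝ] (𝔛 →L[ℝ] ℝ) →ₗ[ℝ] (𝔛 →L[ℝ] ℝ) := LinearMap.mk₂ ℝ
      (fun (a : B) (f : 𝔛 →L[ℝ] ℝ) => F a f)
      (fun a b f => by
        ext y
        have := hN a a.2 b b.2 1 1 y
        simp only [one_smul] at this
        rw [Submodule.coe_add, hF _ (hAadd _ a.2 _ b.2), this, add_apply, hF _ a.2, hF _ b.2,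
          map_add])
      (fun c a f => by
        ext y
        have := hN a a.2 a a.2 c 0 y
        simp only [zero_smul, add_zero] at this
        rw [Submodule.coe_smul, hF _ (hAsmul c _ a.2), this, smul_apply, hF _ a.2, map_smul])
      (fun a f g => by ext y; simp only [add_apply, hF _ a.2])
      (fun c a f => by ext y; simp only [smul_apply, hF _ a.2])
    obtain ⟨l, hl⟩ := LinearMap.exists_extend (K := ℝ) (p := B)
      (V' := (𝔛 →L[ℝ] ℝ) →ₗ[ℝ] (𝔛 →L[ℝ] ℝ)) φ
    exact ⟨l, fun a ha f => congrArg (fun T => T f) (LinearMap.congr_fun hl (⟨a, ha⟩ : B))⟩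
  obtain ⟨l, hl⟩ := linear_extension Mr hMrlin DL hDL
  obtain ⟨r, hr⟩ := linear_extension Ml hMllin DR hDR
  obtain ⟨d, hd⟩ := LinearMap.exists_extend (p := B)
    { toFun := fun a : B => D a
      map_add' := fun a b => hDadd a a.2 b b.2
      map_smul' := fun c a => hDsmul c a a.2 }
  replace hd : ∀ a ∈ A, d a = D a := fun a ha => LinearMap.congr_fun hd (⟨a, ha⟩ : B)
  have hl' : ∀ a ∈ A, ∀ f y, l a f y = f (Mr a y) := fun a ha f y => by rw [hl a ha, hDL a ha]
  have hr' : ∀ a ∈ A, ∀ f y, r a f y = f (Ml a y) := fun a ha f y => by rw [hr a ha, hDR a ha]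
  have comp_mem : ∀ a ∈ A, ∀ b ∈ A, a ∘L b ∈ A :=
    fun a ha b hb => (hAideal b hb a (hAsub ha)).1
  have opNorm_bound : ∀ a ∈ A, ∀ (f g : 𝔛 →L[ℝ] ℝ) (N : 𝔛 → 𝔛), (∀ y, g y = f (N y)) →
      (∀ y, ‖N y‖ ≤ M * rnorm a * ‖y‖) → ‖g‖ ≤ max |M| |C| * rnorm a * ‖f‖ := by
    intro a _ f g N hg hN
    have h0 := rnorm_nonneg a
    refine g.opNorm_le_bound (by positivity) fun y => ?_
    rw [hg]
    calc ‖f (N y)‖ ≤ ‖f‖ * ‖N y‖ := f.le_opNorm _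
      _ ≤ ‖f‖ * (max |M| |C| * rnorm a * ‖y‖) := by
        refine mul_le_mul_of_nonneg_left ((hN y).trans ?_) (norm_nonneg f)
        gcongr
        exact (le_abs_self M).trans (le_max_left _ _)
      _ = _ := by ring
  refine ⟨B, l, r, d, max |M| |C|, ?_, rfl, hl, hr, hd⟩
  refine
    { const_nonneg := by positivity
      comp_mem_left := fun T hT a ha => (hAideal a ha T hT).1
      comp_mem_right := fun a ha T hT => (hAideal a ha T hT).2
      exists_pos_sub := fun a ha => ?_
      left_comp := fun a ha b hb f => ?_
      right_comp := fun a ha b hb f => ?_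
      comm := fun a ha b hb f => ?_
      left_pos := fun a ha hpos f hf y hy => ?_
      right_pos := fun a ha hpos f hf y hy => ?_
      norm_left_le := fun a ha f =>
        opNorm_bound a ha f _ (Mr a) (hl' a ha f) fun y => (hMbd a ha y).2
      norm_right_le := fun a ha f =>
        opNorm_bound a ha f _ (Ml a) (hr' a ha f) fun y => (hMbd a ha y).1
      right_adjoint := fun a ha y => ⟨_, fun f => hr' a ha f y⟩
      map_comp := fun a ha b hb => ?_
      norm_le := fun a ha => ?_ }
  · obtain ⟨m, hm, h₁, h₂, -⟩ := hARiesz a ha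
    refine ⟨(2⁻¹ : ℝ) • (m - -a), hAsmul _ _ (B.sub_mem hm (B.neg_mem ha)), (2⁻¹ : ℝ) • (m - a),
      hAsmul _ _ (B.sub_mem hm ha), fun x hx => smul_nonneg (by norm_num) (h₂ x hx),
      fun x hx => smul_nonneg (by norm_num) (h₁ x hx), by module⟩
  · ext y
    rw [hl' _ (comp_mem a ha b hb), hMrmul a ha b hb, hl' a ha, hl' b hb]
  · ext y
    rw [hr' _ (comp_mem a ha b hb), hMlmul a ha b hb, hr' b hb, hr' a ha]
  · ext y
    rw [hl' a ha, hr' b hb, hr' b hb, hl' a ha, hMlr b hb a ha]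
  · rw [hl' a ha]
    exact hf _ (hMpos a ha hpos y hy).2
  · rw [hr' a ha]
    exact hf _ (hMpos a ha hpos y hy).1
  · rw [hd _ (comp_mem a ha b hb), hd a ha, hd b hb, hl a ha, hr b hb, hDder a ha b hb]
  · rw [hd a ha]
    exact (hC a ha).trans (mul_le_mul_of_nonneg_right
      ((le_abs_self C).trans (le_max_right _ _)) (rnorm_nonneg a))

/-- A linear map which is a limit along an ultrafilter of maps dominated by uniformly bounded
positive linear maps is itself dominated by a positive linear map. -/
theorem regularDerivOn_of_tendsto {ι : Type*} (V : Ultrafilter ι) {A : Submodule ℝ (X →L[ℝ] X)}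
    (hA : ∀ a ∈ A, ∃ p ∈ A, ∃ q ∈ A, IsPosOp p ∧ IsPosOp q ∧ a = p - q)
    (D : (X →L[ℝ] X) →ₗ[ℝ] (𝔛 →L[ℝ] ℝ)) (S : ι → (X →L[ℝ] X) → (𝔛 →L[ℝ] ℝ))
    (hS : ∀ a ∈ A, ∀ y, Tendsto (fun i => S i a y) V (𝓝 (D a y)))
    (Q : ι → (X →L[ℝ] X) →ₗ[ℝ] (𝔛 →L[ℝ] ℝ))
    (hQ : ∀ i, ∀ a ∈ A, IsPosOp a → dualLe 0 (Q i a) ∧ dualLe (S i a) (Q i a))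
    (bound : (X →L[ℝ] X) → ℝ) (hbound : ∀ i, ∀ a ∈ A, IsPosOp a → ‖Q i a‖ ≤ bound a) :
    RegularDerivOn (A : Set (X →L[ℝ] X)) D := by
  have lim : ∀ a, ∃ g : 𝔛 →L[ℝ] ℝ, a ∈ A → ∀ y, Tendsto (fun i => Q i a y) V (𝓝 (g y)) := by
    intro a
    by_cases ha : a ∈ A
    · obtain ⟨p, hp, q, hq, hp0, hq0, rfl⟩ := hA a ha
      obtain ⟨g, hg⟩ := exists_ultrafilter_dual_limit V (fun i => Q i (p - q))
        (bound p + bound q) fun i => by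
          rw [map_sub]
          exact (norm_sub_le _ _).trans (add_le_add (hbound i p hp hp0) (hbound i q hq hq0))
      exact ⟨g, fun _ => hg⟩
    · exact ⟨0, fun h => absurd h ha⟩
  choose P hP using lim
  have P_add : ∀ a ∈ A, ∀ b ∈ A, P (a + b) = P a + P b := fun a ha b hb => by
    ext y
    refine tendsto_nhds_unique (hP _ (A.add_mem ha hb) y) ?_
    simpa using (hP a ha y).add (hP b hb y)
  have P_smul : ∀ (c : ℝ), ∀ a ∈ A, P (c • a) = c • P a := fun c a ha => by
    ext y
    refine tendsto_nhds_unique (hP _ (A.smul_mem c ha) y) ?_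
    simpa using (hP a ha y).const_mul c
  refine ⟨2, ![1, -1], ![P, fun a => P a - D a], fun t => ?_, fun a _ => ?_⟩
  swap
  · simp only [Fin.sum_univ_two, Matrix.cons_val_zero, Matrix.cons_val_one]
    module
  fin_cases t
  · exact ⟨P_add, P_smul, fun a ha ha0 y hy =>
      ge_of_tendsto' (hP a ha y) fun i => (hQ i a ha ha0).1 y hy⟩
  · refine ⟨fun a ha b hb => ?_, fun c a ha => ?_, fun a ha ha0 => ?_⟩
    · change P (a + b) - D (a + b) = (P a - D a) + (P b - D b)
      rw [P_add a ha b hb, map_add]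
      abel
    · change P (c • a) - D (c • a) = c • (P a - D a)
      rw [P_smul c a ha, map_smul, smul_sub]
    · exact dualLe_zero_sub.2 fun y hy => le_of_tendsto_of_tendsto' (hS a ha y) (hP a ha y)
        fun i => (hQ i a ha ha0).2 y hy

end Assembly

theorem nonatomic_main_regularity
    {X 𝔛 : Type*} [NormedAddCommGroup X] [Lattice X] [HasSolidNorm X] [IsOrderedAddMonoid X] [NormedSpace ℝ X] [CompleteSpace X]
    [NormedAddCommGroup 𝔛] [Lattice 𝔛] [HasSolidNorm 𝔛] [IsOrderedAddMonoid 𝔛] [NormedSpace ℝ 𝔛] [CompleteSpace 𝔛]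
    (μ : ℝ) (hμ : 1 ≤ μ)
    -- Π is a directed bounded generating system for X:
    (Pgen : Set (X →L[ℝ] X))
    (hPgpos : ∀ σ ∈ Pgen, IsPosOp σ)
    (hPgproj : ∀ σ ∈ Pgen, σ ∘L σ = σ)
    (hPgbdd : ∃ C : ℝ, ∀ σ ∈ Pgen, ‖σ‖ ≤ C)
    (hPgriesz : ∀ σ ∈ Pgen, ∀ y ∈ Set.range ⇑σ, ∀ z ∈ Set.range ⇑σ, y ⊔ z ∈ Set.range ⇑σ)
    (hPgdense : ∀ (ξ : X) (ε : ℝ), 0 < ε → ∃ σ ∈ Pgen, ∃ y ∈ Set.range ⇑σ, ‖ξ - y‖ < ε)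
    (hPgdir : ∀ σ₁ ∈ Pgen, ∀ σ₂ ∈ Pgen, ∃ σ₃ ∈ Pgen,
      Set.range ⇑σ₁ ⊆ Set.range ⇑σ₃ ∧ Set.range ⇑σ₂ ⊆ Set.range ⇑σ₃)
    -- for each σ ∈ Pgen, (xb σ i) is a basis for σ(X) satisfying (⋆) with constant μ in
    -- each summand (in particular σ(X) ∈ 𝔉_X^{⋆,μ}), with biorthogonal functionals
    -- (xsb σ i) factoring through p_σ; eproj (xb σ) (xsb σ) n is the natural
    -- projection ι_σ e_n^{(σ)} p_σ ∈ ℒʳ(X):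
    (xb : (X →L[ℝ] X) → ℕ → X) (xsb : (X →L[ℝ] X) → ℕ → (X →L[ℝ] ℝ))
    (hxbmem : ∀ σ ∈ Pgen, ∀ i, xb σ i ∈ Set.range ⇑σ)
    (hxsbfac : ∀ σ ∈ Pgen, ∀ i, (xsb σ i).comp σ = xsb σ i)
    (hstarσ : ∀ σ ∈ Pgen, StarSummandBasisOn (Set.range ⇑σ) μ (xb σ))
    (hbiσ : ∀ σ ∈ Pgen, ∀ i j, xsb σ i (xb σ j) = if i = j then (1 : ℝ) else 0)
    (hbasisσ : ∀ σ ∈ Pgen, ∀ y ∈ Set.range ⇑σ,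
      Tendsto (fun n => eproj (xb σ) (xsb σ) n y) atTop (𝓝 y))
    -- (1) each basis (xb σ i) is shrinking (as a basis of σ(X)):
    (hshrinkσ : ∀ σ ∈ Pgen, ∀ l : X →L[ℝ] ℝ,
      Tendsto (fun n => sSup {r : ℝ | ∃ y ∈ Set.range ⇑σ, ‖y‖ ≤ 1 ∧
        r = |l y - l (eproj (xb σ) (xsb σ) n y)|}) atTop (𝓝 0))
    -- 𝒜 is a closed Riesz algebra ideal of ℒʳ(X) (containing the rank-one basis
    -- operators of each σ, so that the 𝒜_σ-module products below make sense):
    (A : Set (X →L[ℝ] X))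
    (hAsub : A ⊆ LrSet X)
    (hAadd : ∀ a ∈ A, ∀ b ∈ A, a + b ∈ A)
    (hAsmul : ∀ (c : ℝ), ∀ a ∈ A, c • a ∈ A)
    (hAideal : ∀ a ∈ A, ∀ T ∈ LrSet X, T ∘L a ∈ A ∧ a ∘L T ∈ A)
    (hARiesz : ∀ a ∈ A, ∃ m ∈ A, opLe a m ∧ opLe (-a) m ∧
      ∀ c ∈ LrSet X, opLe a c → opLe (-a) c → opLe m c)
    (hAclosed : ∀ T ∈ LrSet X, (∀ ε : ℝ, 0 < ε → ∃ a ∈ A, rnorm (T - a) < ε) → T ∈ A)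
    (hAq : ∀ σ ∈ Pgen, ∀ i : ℕ, ((xsb σ i).smulRight (xb σ i)) ∈ A)
    -- (2) 𝒜_σ 𝒜_σ = 𝒜_σ :
    (hAσA : ∀ σ ∈ Pgen, (∀ b ∈ ASigma A σ, ∀ c ∈ ASigma A σ, b ∘L c ∈ ASigma A σ) ∧
      ∀ b ∈ ASigma A σ, ∃ c ∈ ASigma A σ, ∃ d ∈ ASigma A σ, b = c ∘L d)
    -- 𝔛 is a Banach lattice 𝒜-module, with actions Ml, Mr and constant M:
    (Ml Mr : (X →L[ℝ] X) → 𝔛 → 𝔛) (M : ℝ)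
    (hMladd : ∀ a ∈ A, ∀ y₁ y₂ : 𝔛, Ml a (y₁ + y₂) = Ml a y₁ + Ml a y₂)
    (hMradd : ∀ a ∈ A, ∀ y₁ y₂ : 𝔛, Mr a (y₁ + y₂) = Mr a y₁ + Mr a y₂)
    (hMllin : ∀ a ∈ A, ∀ b ∈ A, ∀ (s t : ℝ) (y : 𝔛),
      Ml (s • a + t • b) y = s • Ml a y + t • Ml b y)
    (hMrlin : ∀ a ∈ A, ∀ b ∈ A, ∀ (s t : ℝ) (y : 𝔛),
      Mr (s • a + t • b) y = s • Mr a y + t • Mr b y)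
    (hMlmul : ∀ a ∈ A, ∀ b ∈ A, ∀ y : 𝔛, Ml (a ∘L b) y = Ml a (Ml b y))
    (hMrmul : ∀ a ∈ A, ∀ b ∈ A, ∀ y : 𝔛, Mr (a ∘L b) y = Mr b (Mr a y))
    (hMlr : ∀ a ∈ A, ∀ b ∈ A, ∀ y : 𝔛, Ml a (Mr b y) = Mr b (Ml a y))
    (hMpos : ∀ a ∈ A, IsPosOp a → ∀ y : 𝔛, 0 ≤ y → 0 ≤ Ml a y ∧ 0 ≤ Mr a y)
    (hMbd : ∀ a ∈ A, ∀ y : 𝔛, ‖Ml a y‖ ≤ M * rnorm a * ‖y‖ ∧ ‖Mr a y‖ ≤ M * rnorm a * ‖y‖)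
    -- dual module products on 𝔛′ := 𝔛 →L[ℝ] ℝ :
    (DL DR : (X →L[ℝ] X) → (𝔛 →L[ℝ] ℝ) → (𝔛 →L[ℝ] ℝ))
    (hDL : ∀ a ∈ A, ∀ (x' : 𝔛 →L[ℝ] ℝ) (y : 𝔛), DL a x' y = x' (Mr a y))
    (hDR : ∀ a ∈ A, ∀ (x' : 𝔛 →L[ℝ] ℝ) (y : 𝔛), DR a x' y = x' (Ml a y))
    -- (3) the maps E_σ, F_σ determined by E_σ x′ = sup_n e_n^{(σ)}·x′ and
    -- F_σ x′ = sup_n x′·e_n^{(σ)} have weak*-closed ranges: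
    (Emap Fmap : (X →L[ℝ] X) → (𝔛 →L[ℝ] ℝ) →ₗ[ℝ] (𝔛 →L[ℝ] ℝ))
    (hE : ∀ σ ∈ Pgen, ∀ x' : 𝔛 →L[ℝ] ℝ, dualLe 0 x' →
      dualIsLUB (Set.range fun n => DL (eproj (xb σ) (xsb σ) n) x') (Emap σ x'))
    (hF : ∀ σ ∈ Pgen, ∀ x' : 𝔛 →L[ℝ] ℝ, dualLe 0 x' →
      dualIsLUB (Set.range fun n => DR (eproj (xb σ) (xsb σ) n) x') (Fmap σ x'))
    (hErange : ∀ σ ∈ Pgen, wstarClosed (Set.range (Emap σ)))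
    (hFrange : ∀ σ ∈ Pgen, wstarClosed (Set.range (Fmap σ)))
    -- (4) sup_n e_n^{(σ)}·(a·x′) = a·x′ and sup_n (x′·a)·e_n^{(σ)} = x′·a :
    (hsup : ∀ σ ∈ Pgen, ∀ a ∈ ASigma A σ, IsPosOp a → ∀ x' : 𝔛 →L[ℝ] ℝ, dualLe 0 x' →
      dualIsLUB (Set.range fun n =>
        DL (eproj (xb σ) (xsb σ) n) (DL a x')) (DL a x') ∧
      dualIsLUB (Set.range fun n =>
        DR (eproj (xb σ) (xsb σ) n) (DR a x')) (DR a x'))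
    -- (a) or (b):
    (hcases :
      -- (a): for each σ ∈ Pgen, either the c₀-condition on the corner spaces of 𝔛_σ′,
      --      or σ(X) is reflexive with finite dimensional corner spaces:
      (∀ σ ∈ Pgen,
        (∀ i : ℕ, ∀ ξ : ℕ → (𝔛 →L[ℝ] ℝ),
          ((∀ n : ℕ, ∃ x' : 𝔛 →L[ℝ] ℝ,
              ξ n = DL ((xsb σ n).smulRight (xb σ n))
                      (DR ((xsb σ i).smulRight (xb σ i)) x')) ∨
           (∀ n : ℕ, ∃ x' : 𝔛 →L[ℝ] ℝ,
              ξ n = DL ((xsb σ i).smulRight (xb σ i))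
                      (DR ((xsb σ n).smulRight (xb σ n)) x'))) →
          ¬ ∃ k : ℕ → ℕ, StrictMono k ∧ EquivC0Basis (fun n => ξ (k n))) ∨
        (Function.Surjective
            (NormedSpace.inclusionInDoubleDual ℝ ↥(LinearMap.range (σ : X →ₗ[ℝ] X))) ∧
          ∀ i j : ℕ, ∃ (n : ℕ) (b : Fin n → (𝔛 →L[ℝ] ℝ)),
            ∀ ξ : 𝔛 →L[ℝ] ℝ,
              (∃ x' : 𝔛 →L[ℝ] ℝ,
                ξ = DL ((xsb σ i).smulRight (xb σ i))
                      (DR ((xsb σ j).smulRight (xb σ j)) x')) →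
              ∃ c : Fin n → ℝ, ξ = ∑ t, c t • b t)) ∨
      -- (b): every bounded derivation from 𝒜ʳ(X) to 𝔛′ is inner:
      (∀ D₀ : (X →L[ℝ] X) → (𝔛 →L[ℝ] ℝ),
        (∀ a ∈ ArSet X, ∀ b ∈ ArSet X, D₀ (a + b) = D₀ a + D₀ b) →
        (∀ (r : ℝ), ∀ a ∈ ArSet X, D₀ (r • a) = r • D₀ a) →
        (∀ a ∈ ArSet X, ∀ b ∈ ArSet X, D₀ (a ∘L b) = DL a (D₀ b) + DR b (D₀ a)) →
        (∃ C : ℝ, ∀ a ∈ ArSet X, ‖D₀ a‖ ≤ C * rnorm a) →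
        ∃ ξ : 𝔛 →L[ℝ] ℝ, ∀ a ∈ ArSet X, D₀ a = DL a ξ - DR a ξ))
    -- D is a bounded derivation from 𝒜 to 𝔛′ with D(a) = w*-lim_σ D(σ∘a∘σ):
    (D : (X →L[ℝ] X) → (𝔛 →L[ℝ] ℝ))
    (hDadd : ∀ a ∈ A, ∀ b ∈ A, D (a + b) = D a + D b)
    (hDsmul : ∀ (r : ℝ), ∀ a ∈ A, D (r • a) = r • D a)
    (hDder : ∀ a ∈ A, ∀ b ∈ A, D (a ∘L b) = DL a (D b) + DR b (D a))
    (hDbdd : ∃ C : ℝ, ∀ a ∈ A, ‖D a‖ ≤ C * rnorm a)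
    (hDlim : ∀ a ∈ A, Tendsto
      (fun σ : {σ : X →L[ℝ] X // σ ∈ Pgen} =>
        StrongDual.toWeakDual (D (σ.val ∘L (a ∘L σ.val))))
      (piFilter Pgen) (𝓝 (StrongDual.toWeakDual (D a)))) :
    RegularDerivOn A D := by
  obtain ⟨σ₀, hσ₀, -⟩ := hPgdense 0 1 one_pos
  have hA0 : (0 : X →L[ℝ] X) ∈ A := by simpa using hAsmul 0 _ (hAq σ₀ hσ₀ 0)
  obtain ⟨B, l, r, d, K, hD, rfl, hl, hr, hd⟩ := exists_isBoundedDualDerivation hA0 hAsub hAadd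
    hAsmul hAideal hARiesz hMllin hMrlin hMlmul hMrmul hMlr hMpos hMbd hDL hDR hDadd hDsmul hDder
    hDbdd
  have basis : ∀ σ ∈ Pgen, IsPositiveBasis σ (xb σ) (xsb σ) := fun σ hσ => by
    obtain ⟨-, -, -, -, -, hatom, -⟩ := hstarσ σ hσ
    exact isPositiveBasis_of_atoms (hPgpos σ hσ) (hPgproj σ hσ) (hPgriesz σ hσ) hatom
      (hxsbfac σ hσ) (hbiσ σ hσ) (hbasisσ σ hσ) (hshrinkσ σ hσ)
  obtain ⟨C, hC⟩ := hPgbdd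
  have mem_eproj : ∀ σ ∈ Pgen, ∀ n, eproj (xb σ) (xsb σ) n ∈ B := fun σ hσ =>
    IsBoundedDualDerivation.eproj_mem (hAq σ hσ)
  have left_lim : ∀ σ ∈ Pgen, ∀ a ∈ ASigma (B : Set (X →L[ℝ] X)) σ, ∀ f y,
      Tendsto (fun n => l (eproj (xb σ) (xsb σ) n) (l a f) y) atTop (𝓝 (l a f y)) :=
    fun σ hσ a ha f y => hD.tendsto_left_eproj (basis σ hσ) (hPgproj σ hσ) (hAq σ hσ)
      (fun a ha ha0 f hf => by
        simpa only [hl a ha.1, hl _ (mem_eproj σ hσ _)] using (hsup σ hσ a ha ha0 f hf).1) ha f y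
  have right_lim : ∀ σ ∈ Pgen, ∀ a ∈ ASigma (B : Set (X →L[ℝ] X)) σ, ∀ f y,
      Tendsto (fun n => r (eproj (xb σ) (xsb σ) n) (r a f) y) atTop (𝓝 (r a f y)) :=
    fun σ hσ a ha f y => hD.tendsto_right_eproj (basis σ hσ) (hPgproj σ hσ) (hAq σ hσ)
      (fun a ha ha0 f hf => by
        simpa only [hr a ha.1, hr _ (mem_eproj σ hσ _)] using (hsup σ hσ a ha ha0 f hf).2) ha f y
  have := piFilter_neBot ⟨σ₀, hσ₀⟩ hPgdir
  let W : Ultrafilter {σ : X →L[ℝ] X // σ ∈ Pgen} := Ultrafilter.of (piFilter Pgen)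
  let V : Ultrafilter ({σ : X →L[ℝ] X // σ ∈ Pgen} × ℕ × ℕ) :=
    W.bind fun σ => (hyperfilter ℕ).bind fun n => (hyperfilter ℕ).map fun m => (σ, n, m)
  choose Q hQ using fun i : {σ : X →L[ℝ] X // σ ∈ Pgen} × ℕ × ℕ =>
    hD.exists_dominating_map (basis i.1 i.1.2) (hAq i.1 i.1.2) (hC i.1 i.1.2) i.2.1 i.2.2
  have limit : ∀ a ∈ B, ∀ y, Tendsto (fun i : {σ : X →L[ℝ] X // σ ∈ Pgen} × ℕ × ℕ =>
      d (eproj (xb i.1) (xsb i.1) i.2.1 ∘L (a ∘L eproj (xb i.1) (xsb i.1) i.2.2)) y) V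
      (𝓝 (d a y)) := by
    intro a ha y
    refine tendsto_bind_nhds (G := fun σ : {σ : X →L[ℝ] X // σ ∈ Pgen} =>
      d (σ.1 ∘L (a ∘L σ.1)) y) (f := W) ?_ fun σ => ?_
    · have := ((WeakDual.eval_continuous y).tendsto _).comp (hDlim a ha)
      rw [hd a ha]
      refine (this.mono_left (Ultrafilter.of_le _)).congr fun σ => ?_
      rw [hd _ (hD.compression_mem_ASigma (hPgpos σ σ.2) (hPgproj σ σ.2) ha).1]
      rfl
    · have hb := hD.compression_mem_ASigma (hPgpos σ σ.2) (hPgproj σ σ.2) ha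
      refine tendsto_bind_nhds (f := hyperfilter ℕ) (G := fun n =>
        d (eproj (xb σ) (xsb σ) n ∘L (σ.1 ∘L (a ∘L σ.1))) y) ?_ fun n => ?_
      · obtain ⟨c, hc, e, he, hce⟩ := (hAσA σ σ.2).2 _ hb
        rw [hce]
        exact hD.tendsto_map_eproj_comp (basis σ σ.2) (hAq σ σ.2) (left_lim σ σ.2)
          (right_lim σ σ.2) hc he (hyperfilter ℕ) Nat.hyperfilter_le_atTop y
      · refine tendsto_map'_iff.2 (((hD.tendsto_map_comp_eproj (basis σ σ.2) hb.1
          (IsBoundedDualDerivation.comp_proj (hPgproj σ σ.2) hb.2) n y).mono_left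
          Nat.hyperfilter_le_atTop).congr fun m => ?_)
        have h₁ := (basis σ σ.2).eproj_proj n
        have h₂ := (basis σ σ.2).proj_eproj m
        have : eproj (xb σ) (xsb σ) n ∘L ((σ.1 ∘L (a ∘L σ.1)) ∘L eproj (xb σ) (xsb σ) m) =
            (eproj (xb σ) (xsb σ) n ∘L σ.1) ∘L (a ∘L (σ.1 ∘L eproj (xb σ) (xsb σ) m)) := rfl
        rw [this, h₁, h₂]
        rfl
  obtain ⟨N, c, P, hP, hPD⟩ := regularDerivOn_of_tendsto V hD.exists_pos_sub d
    (fun i a => d (eproj (xb i.1) (xsb i.1) i.2.1 ∘L (a ∘L eproj (xb i.1) (xsb i.1) i.2.2)))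
    limit Q (fun i a ha ha0 => ⟨(hQ i a ha ha0).1, (hQ i a ha ha0).2.1⟩) _
    fun i a ha ha0 => (hQ i a ha ha0).2.2
  exact ⟨N, c, P, hP, fun a ha => by rw [← hd a ha]; exact hPD a ha⟩
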